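/- The longest block of consecutive equal binary digits (0s or 1s) in the binary expansion of 3^K has length o(K) as K → ∞; that is, for every ε > 0 there exists K₀ such that L(3^K) ≤ ε·K for all K ≥ K₀. -/

import Mathlib

/-- `runLength M` is the length of the longest block of consecutive equal binary digits
(`0`s or `1`s) occurring in the binary expansion of `M`. -/
noncomputable def runLength (M : ℕ) : ℕ :=
  sSup {l | ∃ a, a + l ≤ (Nat.digits 2 M).length ∧ ∀ j < l, M.testBit (a + j) = M.testBit a}


section
open MvPolynomial

namespace RothAux

/-- Translation of the variables by `α`. -/
noncomputable def T {n : ℕ} (α : Fin n → ℚ) :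
    MvPolynomial (Fin n) ℚ →ₐ[ℚ] MvPolynomial (Fin n) ℚ :=
  aeval (fun i => X i + C (α i))

theorem T_T {n : ℕ} (α β : Fin n → ℚ) (P : MvPolynomial (Fin n) ℚ) :
    T α (T β P) = T (α + β) P := by
  have : (T α).comp (T β) = T (α + β) := by
    apply MvPolynomial.algHom_ext
    intro i
    simp only [T, AlgHom.comp_apply, aeval_X, map_add, Pi.add_apply]
    rw [← MvPolynomial.algebraMap_eq, AlgHom.commutes]
    ring
  rw [← this]; rfl

theorem T_zero {n : ℕ} (P : MvPolynomial (Fin n) ℚ) : T (0 : Fin n → ℚ) P = P := by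
  have : T (0 : Fin n → ℚ) = AlgHom.id ℚ _ := by
    apply MvPolynomial.algHom_ext
    intro i
    simp [T]
  rw [this]; rfl

theorem T_ne_zero {n : ℕ} (α : Fin n → ℚ) {P : MvPolynomial (Fin n) ℚ} (h : P ≠ 0) :
    T α P ≠ 0 := by
  intro h0
  apply h
  have := T_T (-α) α P
  rw [h0, map_zero, neg_add_cancel, T_zero] at this
  exact this.symm

/-- All exponents of `P` have `φ`-weight at least `θ`. -/
def Ord {n : ℕ} (φ : (Fin n →₀ ℕ) →+ ℝ) (θ : ℝ) (P : MvPolynomial (Fin n) ℚ) : Prop :=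
  ∀ J, coeff J P ≠ 0 → θ ≤ φ J

section Ord
variable {n : ℕ} {φ : (Fin n →₀ ℕ) →+ ℝ}

theorem Ord.mono {a b : ℝ} {P : MvPolynomial (Fin n) ℚ} (h : Ord φ a P) (hab : b ≤ a) :
    Ord φ b P := fun J hJ => hab.trans (h J hJ)

theorem Ord.mul {a b : ℝ} {P Q : MvPolynomial (Fin n) ℚ} (hP : Ord φ a P) (hQ : Ord φ b Q) :
    Ord φ (a + b) (P * Q) := by
  classical
  intro J hJ
  rw [coeff_mul] at hJ
  obtain ⟨x, hx, hne⟩ := Finset.exists_ne_zero_of_sum_ne_zero hJ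
  rw [Finset.HasAntidiagonal.mem_antidiagonal] at hx
  rw [← hx, map_add]
  exact add_le_add (hP _ (left_ne_zero_of_mul hne)) (hQ _ (right_ne_zero_of_mul hne))

theorem Ord.sum {ι : Type*} {s : Finset ι} {a : ℝ} {f : ι → MvPolynomial (Fin n) ℚ}
    (h : ∀ i ∈ s, Ord φ a (f i)) : Ord φ a (∑ i ∈ s, f i) := by
  intro J hJ
  rw [coeff_sum] at hJ
  obtain ⟨x, hx, hne⟩ := Finset.exists_ne_zero_of_sum_ne_zero hJ
  exact h x hx J hne

theorem Ord.smul {a : ℝ} {P : MvPolynomial (Fin n) ℚ} (c : ℚ) (h : Ord φ a P) :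
    Ord φ a (c • P) := by
  intro J hJ
  rw [coeff_smul] at hJ
  exact h J (right_ne_zero_of_smul hJ)

theorem Ord.one : Ord φ 0 1 := by
  classical
  intro J hJ
  rw [coeff_one] at hJ
  have : 0 = J := by by_contra h; simp [h] at hJ
  rw [← this, map_zero]

theorem Ord.prod {ι : Type*} {s : Finset ι} {a : ι → ℝ} {f : ι → MvPolynomial (Fin n) ℚ}
    (h : ∀ i ∈ s, Ord φ (a i) (f i)) : Ord φ (∑ i ∈ s, a i) (∏ i ∈ s, f i) := by
  classical
  induction s using Finset.induction_on with
  | empty => simpa using Ord.one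
  | insert i s hi ih =>
    rw [Finset.sum_insert hi, Finset.prod_insert hi]
    exact (h i (Finset.mem_insert_self _ _)).mul (ih fun j hj => h j (Finset.mem_insert_of_mem hj))

theorem Ord.det {k : ℕ} {a : Fin k → ℝ} {M : Matrix (Fin k) (Fin k) (MvPolynomial (Fin n) ℚ)}
    (h : ∀ i j, Ord φ (a j) (M i j)) : Ord φ (∑ j, a j) M.det := by
  rw [Matrix.det_apply]
  apply Ord.sum
  intro σ _
  have : Ord φ (∑ j, a j) (∏ i, M (σ i) i) := Ord.prod fun i _ => h _ _
  rcases Int.units_eq_one_or (Equiv.Perm.sign σ) with hs | hs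
  · rw [hs, one_smul]; exact this
  · rw [hs]
    have h2 := this.smul (-1)
    simpa [Units.smul_def] using h2

end Ord

/-- The sum of the absolute values of the coefficients. -/
noncomputable def l1 {n : ℕ} (P : MvPolynomial (Fin n) ℚ) : ℝ := ∑ J ∈ P.support, |((coeff J P : ℚ) : ℝ)|

section l1
variable {n : ℕ}

theorem l1_eq {P : MvPolynomial (Fin n) ℚ} {s : Finset (Fin n →₀ ℕ)} (h : P.support ⊆ s) :
    l1 P = ∑ J ∈ s, |((coeff J P : ℚ) : ℝ)| := by
  apply Finset.sum_subset h
  intro J _ hJ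
  rw [notMem_support_iff] at hJ
  simp [hJ]

theorem l1_nonneg (P : MvPolynomial (Fin n) ℚ) : 0 ≤ l1 P :=
  Finset.sum_nonneg fun _ _ => abs_nonneg _

theorem l1_zero : l1 (0 : MvPolynomial (Fin n) ℚ) = 0 := by simp [l1]

theorem l1_add (P Q : MvPolynomial (Fin n) ℚ) : l1 (P + Q) ≤ l1 P + l1 Q := by
  classical
  rw [l1_eq (P := P + Q) (support_add), l1_eq (P := P) Finset.subset_union_left,
    l1_eq (P := Q) Finset.subset_union_right, ← Finset.sum_add_distrib]
  apply Finset.sum_le_sum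
  intro J _
  rw [coeff_add]
  push_cast
  exact abs_add_le _ _

theorem l1_sum {ι : Type*} (s : Finset ι) (f : ι → MvPolynomial (Fin n) ℚ) :
    l1 (∑ i ∈ s, f i) ≤ ∑ i ∈ s, l1 (f i) := by
  classical
  induction s using Finset.induction_on with
  | empty => simp [l1_zero]
  | insert i s hi ih =>
    rw [Finset.sum_insert hi, Finset.sum_insert hi]
    exact (l1_add _ _).trans (by linarith)

theorem l1_monomial (J : Fin n →₀ ℕ) (c : ℚ) : l1 (monomial J c) = |(c : ℝ)| := by
  classical
  rw [l1_eq (s := {J}) support_monomial_subset]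
  simp

theorem l1_mul (P Q : MvPolynomial (Fin n) ℚ) : l1 (P * Q) ≤ l1 P * l1 Q := by
  conv_lhs => rw [P.as_sum, Q.as_sum, Finset.sum_mul_sum]
  refine (l1_sum _ _).trans ?_
  rw [l1, l1, Finset.sum_mul_sum]
  apply Finset.sum_le_sum
  intro I _
  refine (l1_sum _ _).trans ?_
  apply Finset.sum_le_sum
  intro J _
  rw [monomial_mul, l1_monomial]
  push_cast
  rw [abs_mul]

theorem l1_neg (P : MvPolynomial (Fin n) ℚ) : l1 (-P) = l1 P := by
  simp [l1]

theorem l1_one : l1 (1 : MvPolynomial (Fin n) ℚ) = 1 := by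
  have := l1_monomial (0 : Fin n →₀ ℕ) 1
  simpa using this

theorem l1_prod {ι : Type*} (s : Finset ι) (f : ι → MvPolynomial (Fin n) ℚ) :
    l1 (∏ i ∈ s, f i) ≤ ∏ i ∈ s, l1 (f i) := by
  classical
  induction s using Finset.induction_on with
  | empty => simp [l1_one]
  | insert i s hi ih =>
    rw [Finset.prod_insert hi, Finset.prod_insert hi]
    exact (l1_mul _ _).trans (mul_le_mul_of_nonneg_left ih (l1_nonneg _))

theorem l1_det {k : ℕ} {B : ℝ} {M : Matrix (Fin k) (Fin k) (MvPolynomial (Fin n) ℚ)}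
    (h : ∀ i j, l1 (M i j) ≤ B) : l1 M.det ≤ k.factorial * B ^ k := by
  rw [Matrix.det_apply]
  refine (l1_sum _ _).trans ?_
  have : ∀ σ ∈ (Finset.univ : Finset (Equiv.Perm (Fin k))),
      l1 (Equiv.Perm.sign σ • ∏ i, M (σ i) i) ≤ B ^ k := by
    intro σ _
    have h1 : l1 (∏ i, M (σ i) i) ≤ B ^ k := by
      refine (l1_prod _ _).trans ?_
      refine (Finset.prod_le_prod (fun i _ => l1_nonneg _) (fun i _ => h _ _)).trans ?_
      simp
    rcases Int.units_eq_one_or (Equiv.Perm.sign σ) with hs | hs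
    · rw [hs, one_smul]; exact h1
    · rw [hs]
      simpa [Units.smul_def, l1_neg] using h1
  refine (Finset.sum_le_sum this).trans ?_
  simp [Fintype.card_perm]

theorem l1_le_of_inj {m : ℕ} {Q : MvPolynomial (Fin m) ℚ} {P : MvPolynomial (Fin n) ℚ}
    (f : (Fin m →₀ ℕ) → (Fin n →₀ ℕ)) (hf : Function.Injective f) {c : ℝ} (hc : 0 ≤ c)
    (h : ∀ b, coeff b Q ≠ 0 → |((coeff b Q : ℚ) : ℝ)| ≤ c * |((coeff (f b) P : ℚ) : ℝ)|) : l1 Q ≤ c * l1 P := by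
  classical
  have h1 : l1 Q ≤ ∑ b ∈ Q.support, c * |((coeff (f b) P : ℚ) : ℝ)| := by
    apply Finset.sum_le_sum
    intro b hb
    exact h b (mem_support_iff.mp hb)
  refine h1.trans ?_
  rw [← Finset.mul_sum]
  apply mul_le_mul_of_nonneg_left _ hc
  rw [← Finset.sum_image (f := fun J => |((coeff J P : ℚ) : ℝ)|) (s := Q.support) (g := f)
    (fun x _ y _ hxy => hf hxy)]
  rw [l1_eq (P := P) (s := P.support ∪ Q.support.image f) Finset.subset_union_left]
  apply Finset.sum_le_sum_of_subset_of_nonneg Finset.subset_union_right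
  intros; positivity

theorem coeff_le_l1 (P : MvPolynomial (Fin n) ℚ) (J : Fin n →₀ ℕ) : |((coeff J P : ℚ) : ℝ)| ≤ l1 P := by
  by_cases h : J ∈ P.support
  · exact Finset.single_le_sum (f := fun J => |((coeff J P : ℚ) : ℝ)|) (fun _ _ => abs_nonneg _) h
  · rw [notMem_support_iff] at h
    simp [h, l1_nonneg]

end l1

/-- Polynomials with integral coefficients. -/
noncomputable def IntP (n : ℕ) : Subring (MvPolynomial (Fin n) ℚ) :=
  (MvPolynomial.map (σ := Fin n) (Int.castRingHom ℚ)).range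

theorem mem_IntP {n : ℕ} {P : MvPolynomial (Fin n) ℚ} :
    P ∈ IntP n ↔ ∀ J, ∃ z : ℤ, coeff J P = z := by
  constructor
  · rintro ⟨Q, rfl⟩ J
    exact ⟨coeff J Q, by simp [coeff_map]⟩
  · intro h
    choose z hz using h
    rw [P.as_sum]
    refine Subring.sum_mem _ fun J _ => ?_
    exact ⟨monomial J (z J), by simp [map_monomial, hz]⟩

theorem det_IntP {n k : ℕ} {M : Matrix (Fin k) (Fin k) (MvPolynomial (Fin n) ℚ)}
    (h : ∀ i j, M i j ∈ IntP n) : M.det ∈ IntP n := by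
  rw [Matrix.det_apply]
  refine Subring.sum_mem _ fun σ _ => ?_
  rw [Units.smul_def]
  exact Subring.zsmul_mem _ (Subring.prod_mem _ fun i _ => h _ _) _

/-- Iterated partial derivatives along a list of variables. -/
noncomputable def pd {n : ℕ} (L : List (Fin n)) (P : MvPolynomial (Fin n) ℚ) :
    MvPolynomial (Fin n) ℚ := L.foldr (fun i Q => pderiv i Q) P

/-- Multiplicity vector of a list. -/
noncomputable def cnt {n : ℕ} : List (Fin n) → (Fin n →₀ ℕ)
  | [] => 0
  | i :: L => Finsupp.single i 1 + cnt L

theorem coeff_pd {n : ℕ} (L : List (Fin n)) (P : MvPolynomial (Fin n) ℚ) (b : Fin n →₀ ℕ) :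
    coeff b (pd L P) = (∏ i, ((b i + 1).ascFactorial (cnt L i) : ℚ)) * coeff (b + cnt L) P := by
  induction L generalizing b with
  | nil => simp [pd, cnt]
  | cons i L ih =>
    have : pd (i :: L) P = pderiv i (pd L P) := rfl
    rw [this, coeff_pderiv, ih, cnt, add_assoc]
    have h2 : (∏ j, ((b j + 1).ascFactorial ((Finsupp.single i 1 + cnt L : Fin n →₀ ℕ) j) : ℚ)) =
        (∏ j, (((b + Finsupp.single i 1 : Fin n →₀ ℕ) j + 1).ascFactorial (cnt L j) : ℚ)) * (b i + 1) := by
      rw [← Finset.mul_prod_erase _ _ (Finset.mem_univ i),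
        ← Finset.mul_prod_erase _ _ (Finset.mem_univ i)]
      have h3 : ∏ j ∈ Finset.univ.erase i,
          ((b j + 1).ascFactorial ((Finsupp.single i 1 + cnt L : Fin n →₀ ℕ) j) : ℚ) =
          ∏ j ∈ Finset.univ.erase i, (((b + Finsupp.single i 1 : Fin n →₀ ℕ) j + 1).ascFactorial (cnt L j) : ℚ) := by
        apply Finset.prod_congr rfl
        intro j hj
        have hne : j ≠ i := (Finset.mem_erase.mp hj).1
        simp [Finsupp.single_apply, hne.symm]
      rw [h3]
      have h4 : ((b i + 1).ascFactorial ((Finsupp.single i 1 + cnt L : Fin n →₀ ℕ) i) : ℚ) =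
          (((b + Finsupp.single i 1 : Fin n →₀ ℕ) i + 1).ascFactorial (cnt L i) : ℚ) * (b i + 1) := by
        have := Nat.succ_ascFactorial (b i + 1) (cnt L i)
        simp only [Finsupp.add_apply, Finsupp.single_eq_same]
        rw [add_comm 1, Nat.ascFactorial_succ, ← this]
        push_cast; ring
      rw [h4]; ring
    rw [h2]; ring

/-- Normalised iterated partial derivatives. -/
noncomputable def nd {n : ℕ} (L : List (Fin n)) (P : MvPolynomial (Fin n) ℚ) :
    MvPolynomial (Fin n) ℚ := (∏ i, ((cnt L i).factorial : ℚ))⁻¹ • pd L P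

theorem coeff_nd {n : ℕ} (L : List (Fin n)) (P : MvPolynomial (Fin n) ℚ) (b : Fin n →₀ ℕ) :
    coeff b (nd L P) =
      ((∏ i, (b i + cnt L i).choose (cnt L i) : ℕ) : ℚ) * coeff (b + cnt L) P := by
  rw [nd, coeff_smul, coeff_pd, smul_eq_mul, ← mul_assoc]
  congr 1
  rw [inv_mul_eq_iff_eq_mul₀]
  · push_cast
    rw [← Finset.prod_mul_distrib]
    apply Finset.prod_congr rfl
    intro i _
    rw [Nat.ascFactorial_eq_factorial_mul_choose]
    push_cast; rfl
  · exact Finset.prod_ne_zero_iff.mpr fun i _ => by positivity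

theorem nd_IntP {n : ℕ} (L : List (Fin n)) {P : MvPolynomial (Fin n) ℚ} (h : P ∈ IntP n) :
    nd L P ∈ IntP n := by
  rw [mem_IntP] at h ⊢
  intro J
  obtain ⟨z, hz⟩ := h (J + cnt L)
  exact ⟨(∏ i, (J i + cnt L i).choose (cnt L i) : ℕ) * z, by rw [coeff_nd, hz]; push_cast; rfl⟩

/-- Degree bounds. -/
def Deg {n : ℕ} (r : Fin n → ℕ) (P : MvPolynomial (Fin n) ℚ) : Prop :=
  ∀ J, coeff J P ≠ 0 → ∀ i, J i ≤ r i

theorem nd_Deg {n : ℕ} (L : List (Fin n)) {P : MvPolynomial (Fin n) ℚ} {r : Fin n → ℕ}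
    (h : Deg r P) : Deg r (nd L P) := by
  intro J hJ i
  rw [coeff_nd] at hJ
  have := h _ (right_ne_zero_of_mul hJ) i
  simp at this
  omega

theorem l1_nd {n : ℕ} (L : List (Fin n)) {P : MvPolynomial (Fin n) ℚ} {r : Fin n → ℕ}
    (h : Deg r P) : l1 (nd L P) ≤ 2 ^ (∑ i, r i) * l1 P := by
  apply l1_le_of_inj (fun b => b + cnt L) (add_left_injective _) (by positivity)
  intro b hb
  rw [coeff_nd] at hb ⊢
  have h1 := h _ (right_ne_zero_of_mul hb)
  rw [Rat.cast_mul, abs_mul]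
  apply mul_le_mul_of_nonneg_right _ (abs_nonneg _)
  rw [Rat.cast_natCast, abs_of_nonneg (by positivity), ← Finset.prod_pow_eq_pow_sum]
  push_cast
  apply Finset.prod_le_prod (fun i _ => by positivity)
  intro i _
  have h2 := h1 i
  simp only [Finsupp.add_apply] at h2
  have h3 : (b i + cnt L i).choose (cnt L i) ≤ 2 ^ r i :=
    (Nat.choose_le_two_pow _ _).trans (Nat.pow_le_pow_right (by norm_num) h2)
  exact_mod_cast h3

theorem T_pderiv {n : ℕ} (α : Fin n → ℚ) (i : Fin n) (P : MvPolynomial (Fin n) ℚ) :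
    T α (pderiv i P) = pderiv i (T α P) := by
  induction P using MvPolynomial.induction_on with
  | C a => 
    rw [pderiv_C, map_zero, ← algebraMap_eq, AlgHom.commutes, algebraMap_eq, pderiv_C]
  | add p q hp hq => simp [hp, hq]
  | mul_X p j hp =>
    have h1 : T α (X j) = X j + C (α j) := by simp [T]
    rw [Derivation.leibniz, map_add, map_mul (T α) p, Derivation.leibniz, h1]
    simp only [smul_eq_mul, map_mul, h1, hp, pderiv_X, map_add, pderiv_C, add_zero]
    congr 2
    by_cases hij : i = j
    · subst hij; simp
    · simp [Pi.single_apply, hij]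

theorem T_pd {n : ℕ} (α : Fin n → ℚ) (L : List (Fin n)) (P : MvPolynomial (Fin n) ℚ) :
    T α (pd L P) = pd L (T α P) := by
  induction L with
  | nil => rfl
  | cons i L ih =>
    have h : ∀ Q, pd (i :: L) Q = pderiv i (pd L Q) := fun _ => rfl
    rw [h, h, T_pderiv, ih]

theorem T_nd {n : ℕ} (α : Fin n → ℚ) (L : List (Fin n)) (P : MvPolynomial (Fin n) ℚ) :
    T α (nd L P) = nd L (T α P) := by
  rw [nd, nd, map_smul, T_pd]

theorem Ord_nd {n : ℕ} {φ : (Fin n →₀ ℕ) →+ ℝ} {θ : ℝ} {P : MvPolynomial (Fin n) ℚ}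
    (L : List (Fin n)) (h : Ord φ θ P) : Ord φ (θ - φ (cnt L)) (nd L P) := by
  intro J hJ
  rw [coeff_nd] at hJ
  have := h _ (right_ne_zero_of_mul hJ)
  rw [map_add] at this
  linarith

end RothAux
end

section
open MvPolynomial

namespace RothAux

section Wronskian
variable {R : Type*} [CommRing R] [IsDomain R] [Algebra ℚ R] {S : Type*} (d : S → Derivation ℚ R R)

/-- Iterated derivations along a list. -/
def itd (L : List S) (f : R) : R := L.foldr (fun s x => d s x) f

/-- Membership in the saturation of the span of a family of vectors. -/
def Sat {i k : ℕ} (v : Fin i → Fin k → R) (x : Fin k → R) : Prop :=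
  ∃ c : R, c ≠ 0 ∧ ∃ a : Fin i → R, ∀ j, c * x j = ∑ b, a b * v b j

theorem Sat.self {i k : ℕ} (v : Fin i → Fin k → R) (b : Fin i) : Sat v (v b) :=
  ⟨1, one_ne_zero, fun b' => if b' = b then 1 else 0, fun j => by simp⟩

theorem Sat.zero {i k : ℕ} (v : Fin i → Fin k → R) : Sat v 0 :=
  ⟨1, one_ne_zero, 0, fun j => by simp⟩

theorem Sat.add {i k : ℕ} {v : Fin i → Fin k → R} {x y : Fin k → R} (hx : Sat v x) (hy : Sat v y) :
    Sat v (x + y) := by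
  obtain ⟨c, hc, a, ha⟩ := hx
  obtain ⟨e, he, b, hb⟩ := hy
  refine ⟨c * e, mul_ne_zero hc he, fun t => e * a t + c * b t, fun j => ?_⟩
  simp only [add_mul, Finset.sum_add_distrib, mul_assoc, ← Finset.mul_sum, ← ha, ← hb, Pi.add_apply]
  ring

theorem Sat.smul {i k : ℕ} {v : Fin i → Fin k → R} {x : Fin k → R} (u : R) (hx : Sat v x) :
    Sat v (u • x) := by
  obtain ⟨c, hc, a, ha⟩ := hx
  refine ⟨c, hc, fun t => u * a t, fun j => ?_⟩
  simp only [mul_assoc, ← Finset.mul_sum, ← ha, Pi.smul_apply, smul_eq_mul]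
  ring

theorem Sat.sum {i k : ℕ} {v : Fin i → Fin k → R} {ι : Type*} (s : Finset ι) (f : ι → Fin k → R)
    (h : ∀ t ∈ s, Sat v (f t)) : Sat v (∑ t ∈ s, f t) := by
  classical
  induction s using Finset.induction_on with
  | empty => simpa using Sat.zero v
  | insert t s ht ih =>
    rw [Finset.sum_insert ht]
    exact (h t (Finset.mem_insert_self _ _)).add (ih fun j hj => h j (Finset.mem_insert_of_mem hj))

theorem Sat.of_smul {i k : ℕ} {v : Fin i → Fin k → R} {x : Fin k → R} {u : R} (hu : u ≠ 0)
    (hx : Sat v (u • x)) : Sat v x := by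
  obtain ⟨c, hc, a, ha⟩ := hx
  refine ⟨c * u, mul_ne_zero hc hu, a, fun j => ?_⟩
  rw [← ha]
  simp [mul_assoc]

theorem Sat.deriv {i k : ℕ} {v : Fin i → Fin k → R} {x : Fin k → R} (D : Derivation ℚ R R)
    (hD : ∀ b, Sat v (fun j => D (v b j))) (hx : Sat v x) : Sat v (fun j => D (x j)) := by
  have hx' := hx
  obtain ⟨c, hc, a, ha⟩ := hx
  apply Sat.of_smul hc
  have : (c • fun j => D (x j)) =
      (∑ b, (D (a b) • v b + a b • fun j => D (v b j))) + (-D c) • x := by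
    funext j
    have h1 := congrArg D (ha j)
    rw [Derivation.leibniz, map_sum] at h1
    simp only [Derivation.leibniz, smul_eq_mul] at h1
    simp only [Pi.smul_apply, Pi.add_apply, Finset.sum_apply, smul_eq_mul]
    have h2 : ∑ b, (D (a b) * v b j + a b * D (v b j)) =
      ∑ b, (a b * D (v b j) + v b j * D (a b)) := by
      apply Finset.sum_congr rfl; intros; ring
    rw [h2, ← h1]; ring
  rw [this]
  refine Sat.add (Sat.sum _ _ fun b _ => ?_) (hx'.smul _)
  exact ((Sat.self v b).smul _).add ((hD b).smul _)

theorem genW {k : ℕ} (f : Fin k → R)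
    (hcomp : ∀ g : Fin k → R, g ≠ 0 → ∃ L, ∑ j, g j * itd d L (f j) ≠ 0) :
    ∃ L : Fin k → List S, (∀ i, (L i).length < k) ∧
      (Matrix.of fun i j => itd d (L i) (f j)).det ≠ 0 := by
  have key : ∀ i ≤ k, ∃ L : Fin i → List S, (∀ b, (L b).length < i) ∧
      LinearIndependent R (fun b => (fun j => itd d (L b) (f j) : Fin k → R)) := by
    intro i
    induction i with
    | zero => intro _; exact ⟨Fin.elim0, fun b => b.elim0, linearIndependent_empty_type⟩
    | succ i ih =>
      intro hik
      obtain ⟨L, hL, hli⟩ := ih (by omega)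
      set v : Fin i → Fin k → R := fun b => (fun j => itd d (L b) (f j)) with hv
      have hex : ∃ L' : List S, L'.length < i + 1 ∧ ¬ Sat v (fun j => itd d L' (f j)) := by
        by_contra hcon
        push Not at hcon
        have hall : ∀ L' : List S, Sat v (fun j => itd d L' (f j)) := by
          intro L'
          induction L' with
          | nil => exact hcon [] (by simp)
          | cons s L' ih' =>
            refine Sat.deriv (d s) (fun b => ?_) ih'
            exact hcon (s :: L b) (by simpa using hL b)
        let F : (Fin k → R) →ₗ[R] (Fin i → R) := Matrix.mulVecLin (Matrix.of v)
        have hF : ¬ Function.Injective F := by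
          intro hinj
          have := le_of_fin_injective R F hinj
          omega
        rw [← LinearMap.ker_eq_bot, Submodule.eq_bot_iff] at hF
        push Not at hF
        obtain ⟨g, hg, hg0⟩ := hF
        obtain ⟨L', hL'⟩ := hcomp g hg0
        obtain ⟨c, hc, a, ha⟩ := hall L'
        apply hL'
        have h0 : c * ∑ j, g j * itd d L' (f j) = 0 := by
          rw [Finset.mul_sum]
          have : ∀ j, c * (g j * itd d L' (f j)) = ∑ b, a b * (v b j * g j) := by
            intro j
            rw [mul_left_comm, ha, Finset.mul_sum]
            apply Finset.sum_congr rfl; intros; ring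
          simp_rw [this]
          rw [Finset.sum_comm]
          apply Finset.sum_eq_zero
          intro b _
          rw [← Finset.mul_sum]
          have hb := congrFun (LinearMap.mem_ker.mp hg) b
          have : ∑ j, v b j * g j = 0 := hb
          rw [this, mul_zero]
        exact (mul_eq_zero.mp h0).resolve_left hc
      obtain ⟨L', hlen, hnot⟩ := hex
      refine ⟨Fin.cons L' L, ?_, ?_⟩
      · intro b
        refine Fin.cases ?_ (fun b => ?_) b
        · simpa using hlen
        · have := hL b
          simp only [Fin.cons_succ]; omega
      · have h2 := LinearIndependent.fin_cons' (fun j => itd d L' (f j)) v hli (by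
          intro c y hy hcy
          by_contra hc
          apply hnot
          obtain ⟨a, ha⟩ := (Submodule.mem_span_range_iff_exists_fun R).mp hy
          refine ⟨c, hc, fun b => - a b, fun j => ?_⟩
          have h3 := congrFun hcy j
          rw [← ha] at h3
          simp only [Pi.add_apply, Pi.smul_apply, smul_eq_mul, Finset.sum_apply, Pi.zero_apply] at h3
          simp only [neg_mul, Finset.sum_neg_distrib]
          linear_combination h3)
        have h3 : (fun b => (fun j => itd d ((Fin.cons L' L : Fin (i + 1) → List S) b) (f j) :
            Fin k → R)) = (Fin.cons (fun j => itd d L' (f j)) v : Fin (i + 1) → Fin k → R) := by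
          funext b
          refine Fin.cases ?_ (fun b => ?_) b <;> simp [v]
        rw [h3]
        exact h2
  obtain ⟨L, hL, hli⟩ := key k le_rfl
  refine ⟨L, hL, fun h0 => ?_⟩
  obtain ⟨a, ha, ha0⟩ := Matrix.exists_vecMul_eq_zero_iff.mpr h0
  apply ha
  rw [Fintype.linearIndependent_iff] at hli
  funext b
  refine hli a ?_ b
  funext j
  have := congrFun ha0 j
  simpa [Matrix.vecMul, dotProduct] using this

end Wronskian

theorem pd_sum {n : ℕ} {ι : Type*} (s : Finset ι) (L : List (Fin n)) (c : ι → ℚ)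
    (f : ι → MvPolynomial (Fin n) ℚ) :
    pd L (∑ i ∈ s, c i • f i) = ∑ i ∈ s, c i • pd L (f i) := by
  induction L with
  | nil => rfl
  | cons i L ih =>
    have h : ∀ Q, pd (i :: L) Q = pderiv i (pd L Q) := fun _ => rfl
    rw [h, ih, map_sum]
    apply Finset.sum_congr rfl
    intro t _
    rw [h, Derivation.map_smul]

theorem cnt_surj {n : ℕ} (J : Fin n →₀ ℕ) : ∃ L, cnt L = J := by
  classical
  induction J using Finsupp.induction_linear with
  | zero => exact ⟨[], rfl⟩
  | add f g hf hg =>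
    obtain ⟨L, rfl⟩ := hf
    obtain ⟨L', rfl⟩ := hg
    refine ⟨L ++ L', ?_⟩
    induction L with
    | nil => simp [cnt]
    | cons i L ih => simp [cnt, ih, add_assoc]
  | single i m =>
    refine ⟨List.replicate m i, ?_⟩
    induction m with
    | zero => simp [cnt]
    | succ m ih => rw [List.replicate_succ, cnt, ih, ← Finsupp.single_add, add_comm]

theorem coeff_zero_T {n : ℕ} (a : Fin n → ℚ) (Q : MvPolynomial (Fin n) ℚ) :
    coeff 0 (T a Q) = eval a Q := by
  have h : (constantCoeff (R := ℚ) (σ := Fin n)).comp (T a : _ →+* _) = eval a := by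
    apply MvPolynomial.ringHom_ext
    · intro r; simp [T]
    · intro i; simp [T]
  exact RingHom.congr_fun h Q

theorem genW_mv {n k : ℕ} (f : Fin k → MvPolynomial (Fin n) ℚ) (hf : LinearIndependent ℚ f) :
    ∃ L : Fin k → List (Fin n), (∀ i, (L i).length < k) ∧
      (Matrix.of fun i j => pd (L i) (f j)).det ≠ 0 := by
  refine genW (fun i : Fin n => (pderiv i : Derivation ℚ _ (MvPolynomial (Fin n) ℚ))) f ?_
  intro g hg
  by_contra hcon
  push Not at hcon
  obtain ⟨j0, hj0⟩ := Function.ne_iff.mp hg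
  have : ∃ a, eval a (g j0) ≠ 0 := by
    by_contra h
    push Not at h
    apply hj0
    apply MvPolynomial.funext
    intro x
    simpa using h x
  obtain ⟨a, ha⟩ := this
  have hcon' : ∀ L : List (Fin n), ∑ j, g j * pd L (f j) = 0 := hcon
  have h0 : ∑ j, (eval a (g j)) • f j = 0 := by
    by_contra hne
    apply T_ne_zero a hne
    ext J
    obtain ⟨L, rfl⟩ := cnt_surj J
    set h := ∑ j, (eval a (g j)) • f j with hh
    have h1 : eval a (pd L h) = 0 := by
      rw [hh, pd_sum, map_sum]
      have := congrArg (eval a) (hcon' L)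
      rw [map_sum, map_zero] at this
      rw [← this]
      apply Finset.sum_congr rfl
      intro j _
      rw [smul_eval, map_mul]
    rw [← coeff_zero_T, T_pd, coeff_pd, zero_add] at h1
    rw [coeff_zero]
    refine (mul_eq_zero.mp h1).resolve_left ?_
    refine Finset.prod_ne_zero_iff.mpr fun i _ => ?_
    exact_mod_cast (Nat.ascFactorial_pos _ _).ne'
  exact ha (Fintype.linearIndependent_iff.mp hf _ h0 j0)

theorem genW_poly {k : ℕ} (f : Fin k → Polynomial ℚ) (hf : LinearIndependent ℚ f) :
    ∃ e : Fin k → Fin k, Function.Bijective e ∧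
      (Matrix.of fun i j => (Polynomial.derivative^[(e i : ℕ)] (f j))).det ≠ 0 := by
  have hit : ∀ (L : List Unit) (h : Polynomial ℚ),
      itd (fun _ : Unit => (Polynomial.derivative' : Derivation ℚ _ (Polynomial ℚ))) L h =
      Polynomial.derivative^[L.length] h := by
    intro L h
    induction L with
    | nil => rfl
    | cons s L ih =>
      rw [List.length_cons, Function.iterate_succ_apply', ← ih]
      rfl
  obtain ⟨L, hL, hdet⟩ := genW
      (fun _ : Unit => (Polynomial.derivative' : Derivation ℚ _ (Polynomial ℚ))) f (by
    intro g hg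
    by_contra hcon
    push Not at hcon
    obtain ⟨j0, hj0⟩ := Function.ne_iff.mp hg
    have : ∃ a, (g j0).eval a ≠ 0 := by
      by_contra h
      push Not at h
      apply hj0
      apply Polynomial.funext
      intro x
      simpa using h x
    obtain ⟨a, ha⟩ := this
    have h0 : ∑ j, ((g j).eval a) • f j = 0 := by
      set h := ∑ j, ((g j).eval a) • f j with hh
      apply Polynomial.taylor_injective a
      rw [map_zero]
      ext m
      rw [Polynomial.taylor_coeff, Polynomial.coeff_zero]
      have h1 : (Polynomial.derivative^[m] h).eval a = 0 := by
        have h2 := hcon (List.replicate m ())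
        simp only [hit, List.length_replicate] at h2
        have h3 := congrArg (Polynomial.eval a) h2
        rw [Polynomial.eval_finset_sum, Polynomial.eval_zero] at h3
        rw [hh, Polynomial.iterate_derivative_sum, Polynomial.eval_finset_sum, ← h3]
        apply Finset.sum_congr rfl
        intro j _
        rw [Polynomial.iterate_derivative_smul, Polynomial.eval_smul, Polynomial.eval_mul, smul_eq_mul]
      rw [← Polynomial.factorial_smul_hasseDeriv] at h1
      simp only [LinearMap.smul_apply, Polynomial.eval_smul, Pi.smul_apply] at h1
      rw [nsmul_eq_mul] at h1
      refine (mul_eq_zero.mp h1).resolve_left ?_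
      positivity
    exact ha (Fintype.linearIndependent_iff.mp hf _ h0 j0))
  simp only [hit] at hdet
  refine ⟨fun i => ⟨(L i).length, hL i⟩, ?_, hdet⟩
  apply Finite.injective_iff_bijective.mp
  intro x y hxy
  by_contra hne
  apply hdet
  apply Matrix.det_zero_of_row_eq hne
  funext j
  simp only [Matrix.of_apply]
  rw [Fin.mk.injEq] at hxy
  rw [hxy]

end RothAux
end

section
open MvPolynomial

namespace RothAux

/-- Embedding of polynomials in the last `n` variables. -/
noncomputable def io {n : ℕ} : MvPolynomial (Fin n) ℚ →ₐ[ℚ] MvPolynomial (Fin (n + 1)) ℚ :=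
  rename Fin.succ

/-- Embedding of polynomials in the first variable. -/
noncomputable def ps {n : ℕ} : Polynomial ℚ →ₐ[ℚ] MvPolynomial (Fin (n + 1)) ℚ :=
  Polynomial.aeval (X 0)

theorem fse_io {n : ℕ} (U : MvPolynomial (Fin n) ℚ) :
    finSuccEquiv ℚ n (io U) = Polynomial.C U := by
  induction U using MvPolynomial.induction_on with
  | C a => simp [io, finSuccEquiv_apply]
  | add p q hp hq => simp [hp, hq]
  | mul_X p j hp =>
    rw [map_mul, map_mul, hp]
    simp [io, finSuccEquiv_X_succ]

theorem fse_ps {n : ℕ} (W : Polynomial ℚ) :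
    finSuccEquiv ℚ n (ps W) = W.map (C : ℚ →+* MvPolynomial (Fin n) ℚ) := by
  have : ((finSuccEquiv ℚ n).toAlgHom.comp ps) =
      (Polynomial.mapAlgHom (Algebra.ofId ℚ (MvPolynomial (Fin n) ℚ))) := by
    apply Polynomial.algHom_ext
    simp [ps, finSuccEquiv_X_zero]
  exact AlgHom.congr_fun this W

theorem coeff_io_ps {n : ℕ} (U : MvPolynomial (Fin n) ℚ) (W : Polynomial ℚ) (J : Fin n →₀ ℕ)
    (j : ℕ) : coeff (J.cons j) (io U * ps W) = coeff J U * W.coeff j := by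
  rw [← finSuccEquiv_coeff_coeff, map_mul, fse_io, fse_ps, Polynomial.coeff_C_mul,
    Polynomial.coeff_map, mul_comm, coeff_C_mul, mul_comm]

theorem T_io {n : ℕ} (α : Fin (n + 1) → ℚ) (U : MvPolynomial (Fin n) ℚ) :
    T α (io U) = io (T (fun i => α i.succ) U) := by
  have : (T α).comp io = io.comp (T (fun i => α i.succ)) := by
    apply MvPolynomial.algHom_ext
    intro i
    simp [io, T]
  exact AlgHom.congr_fun this U

theorem T_ps {n : ℕ} (α : Fin (n + 1) → ℚ) (W : Polynomial ℚ) :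
    T α (ps W) = ps (Polynomial.taylor (α 0) W) := by
  have : (T α).comp ps = ps.comp (Polynomial.taylorAlgHom (α 0)) := by
    apply Polynomial.algHom_ext
    simp [ps, T, MvPolynomial.algebraMap_eq]
  exact AlgHom.congr_fun this W

theorem pderiv_succ {n : ℕ} (i : Fin n) (U : MvPolynomial (Fin n) ℚ) (W : Polynomial ℚ) :
    pderiv i.succ (io U * ps W) = io (pderiv i U) * ps W := by
  have h1 : pderiv i.succ (ps W : MvPolynomial (Fin (n + 1)) ℚ) = 0 := by
    induction W using Polynomial.induction_on' with
    | add p q hp hq => simp [hp, hq]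
    | monomial m a => 
      rw [← Polynomial.C_mul_X_pow_eq_monomial]
      simp [ps, Derivation.leibniz_pow, pderiv_X_of_ne (Fin.succ_ne_zero i).symm]
  have h2 : pderiv i.succ (io U) = io (pderiv i U) := by
    rw [io]
    exact pderiv_rename (Fin.succ_injective n) _ _
  rw [Derivation.leibniz, h1, h2]
  simp [mul_comm]

theorem pderiv_zero {n : ℕ} (U : MvPolynomial (Fin n) ℚ) (W : Polynomial ℚ) :
    pderiv 0 (io U * ps W) = io U * ps (Polynomial.derivative W) := by
  have h1 : pderiv 0 (ps W : MvPolynomial (Fin (n + 1)) ℚ) = ps (Polynomial.derivative W) := by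
    induction W using Polynomial.induction_on' with
    | add p q hp hq => simp [hp, hq]
    | monomial m a => 
      rw [Polynomial.derivative_monomial, ← Polynomial.C_mul_X_pow_eq_monomial,
        ← Polynomial.C_mul_X_pow_eq_monomial]
      simp [ps, Derivation.leibniz_pow, mul_assoc]
  have h2 : pderiv 0 (io U) = 0 := by
    induction U using MvPolynomial.induction_on with
    | C a => simp [io]
    | add p q hp hq => simp [hp, hq]
    | mul_X p j hp => 
      rw [map_mul, Derivation.leibniz, hp]
      simp [io, pderiv_X_of_ne (Fin.succ_ne_zero j)]
  rw [Derivation.leibniz, h1, h2]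
  simp

theorem pd_io_ps {n : ℕ} (L : List (Fin n)) (j : ℕ) (U : MvPolynomial (Fin n) ℚ)
    (W : Polynomial ℚ) : pd (L.map Fin.succ ++ List.replicate j 0) (io U * ps W) =
      io (pd L U) * ps (Polynomial.derivative^[j] W) := by
  have hc : ∀ {m : ℕ} (i : Fin m) L Q, pd (i :: L) Q = pderiv i (pd L Q) := fun _ _ _ => rfl
  induction L with
  | nil =>
    have h0 : pd [] U = U := rfl
    rw [h0]
    simp only [List.map_nil, List.nil_append]
    induction j with
    | zero => rfl
    | succ j ih =>
      rw [List.replicate_succ, hc, ih, pderiv_zero, Function.iterate_succ_apply']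
  | cons i L ih =>
    rw [List.map_cons, List.cons_append, hc, ih, pderiv_succ, hc]

theorem cnt_append {n : ℕ} (L L' : List (Fin n)) : cnt (L ++ L') = cnt L + cnt L' := by
  induction L with
  | nil => simp [cnt]
  | cons i L ih => simp [cnt, ih, add_assoc]

theorem exists_decomp {n : ℕ} {r : Fin (n + 1) → ℕ} {P : MvPolynomial (Fin (n + 1)) ℚ}
    (hP : P ≠ 0) (hr : Deg r P) :
    ∃ k : ℕ, 0 < k ∧ k ≤ r 0 + 1 ∧ ∃ (f : Fin k → MvPolynomial (Fin n) ℚ)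
      (g : Fin k → Polynomial ℚ), LinearIndependent ℚ f ∧ LinearIndependent ℚ g ∧
      P = ∑ i, io (f i) * ps (g i) := by
  set c : Fin (r 0 + 1) → MvPolynomial (Fin n) ℚ := fun j => (finSuccEquiv ℚ n P).coeff j with hc
  set S := Submodule.span ℚ (Set.range c) with hS
  have hfd : FiniteDimensional ℚ S := FiniteDimensional.span_of_finite ℚ (Set.finite_range c)
  set k := Module.finrank ℚ S with hk
  let b := Module.finBasis ℚ S
  have hcS : ∀ j, c j ∈ S := fun j => Submodule.subset_span ⟨j, rfl⟩
  let f : Fin k → MvPolynomial (Fin n) ℚ := fun i => (b i : MvPolynomial (Fin n) ℚ)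
  let g : Fin k → Polynomial ℚ := fun i =>
    ∑ j : Fin (r 0 + 1), (b.repr ⟨c j, hcS j⟩ i) • Polynomial.X ^ (j : ℕ)
  have hPc : P = ∑ j, io (c j) * ps (Polynomial.X ^ (j : ℕ)) := by
    apply (finSuccEquiv ℚ n).injective
    rw [map_sum]
    have hd : (finSuccEquiv ℚ n P).natDegree < r 0 + 1 := by
      rw [natDegree_finSuccEquiv, Nat.lt_succ_iff, degreeOf_le_iff]
      intro m hm
      exact hr m (mem_support_iff.mp hm) 0
    conv_lhs => rw [Polynomial.as_sum_range' _ _ hd]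
    rw [Finset.sum_range]
    apply Finset.sum_congr rfl
    intro j _
    rw [map_mul, fse_io, fse_ps]
    simp [hc, Polynomial.C_mul_X_pow_eq_monomial]
  have hPfg : P = ∑ i, io (f i) * ps (g i) := by
    rw [hPc]
    simp only [g, map_sum, map_smul, Finset.mul_sum, mul_smul_comm]
    rw [Finset.sum_comm]
    apply Finset.sum_congr rfl
    intro j _
    have h1 : c j = ∑ i, (b.repr ⟨c j, hcS j⟩ i) • f i := by
      have h2 := b.sum_repr ⟨c j, hcS j⟩
      have h3 := congrArg (Subtype.val) h2
      refine Eq.trans h3.symm ?_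
      rw [AddSubmonoidClass.coe_finset_sum]
      rfl
    conv_lhs => rw [h1]
    simp only [map_sum, map_smul, Finset.sum_mul, smul_mul_assoc]
    rfl
  refine ⟨k, ?_, ?_, f, g, ?_, ?_, hPfg⟩
  · rcases Nat.eq_zero_or_pos k with h | h
    · exfalso
      apply hP
      have : IsEmpty (Fin k) := by rw [h]; infer_instance
      rw [hPfg, Fintype.sum_empty]
    · exact h
  · have := finrank_range_le_card (R := ℚ) c
    simpa [Set.finrank] using this
  · exact b.linearIndependent.map' S.subtype (Submodule.ker_subtype S)
  · rw [Fintype.linearIndependent_iff]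
    intro a ha
    have h1 : ∀ j : Fin (r 0 + 1), ∑ i, a i * b.repr ⟨c j, hcS j⟩ i = 0 := by
      intro j
      have h2 := congrArg (fun p => Polynomial.coeff p (j : ℕ)) ha
      simp only [g, Polynomial.finset_sum_coeff, Polynomial.coeff_smul, Polynomial.coeff_X_pow,
        smul_eq_mul, Polynomial.coeff_zero] at h2
      rw [← h2]
      apply Finset.sum_congr rfl
      intro i _
      congr 1
      rw [Finset.sum_eq_single j]
      · simp
      · intro j' _ hne
        have : (j : ℕ) ≠ (j' : ℕ) := fun h => hne (Fin.ext h.symm)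
        simp [this]
      · simp
    let Λ : S →ₗ[ℚ] ℚ := ∑ i, a i • b.coord i
    have hΛ : ∀ x : S, Λ x = 0 := by
      rintro ⟨x, hx⟩
      have hx' := hx
      rw [hS] at hx'
      induction hx' using Submodule.span_induction with
      | mem x hx1 =>
        obtain ⟨j, rfl⟩ := hx1
        have := h1 j
        simpa [Λ] using this
      | zero => exact map_zero Λ
      | add x y hx1 hy1 h1 h2 =>
        have := map_add Λ ⟨x, hx1⟩ ⟨y, hy1⟩
        rw [h1 hx1, h2 hy1, add_zero] at this
        exact this
      | smul t x hx1 h1 =>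
        have := map_smul Λ t ⟨x, hx1⟩
        rw [h1 hx1, smul_zero] at this
        exact this
    intro i
    have := hΛ (b i)
    simpa [Λ, Finsupp.single_apply] using this

theorem univ_index {W : Polynomial ℚ} (hW : W ≠ 0) (hintg : ∀ j, ∃ z : ℤ, W.coeff j = z) {B : ℝ}
    (hB : ∀ j, |((W.coeff j : ℚ) : ℝ)| ≤ B) {p q : ℤ} (hp : p ≠ 0) (hq : q ≠ 0) (hpq : IsCoprime p q) :
    ∃ j, (Polynomial.taylor ((p : ℚ) / q) W).coeff j ≠ 0 ∧ |(p : ℝ)| ^ j ≤ B := by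
  set α : ℚ := (p : ℚ) / q with hα
  have hqQ : (q : ℚ) ≠ 0 := by exact_mod_cast hq
  set j := W.rootMultiplicity α with hj
  refine ⟨j, ?_, ?_⟩
  · -- the Taylor coefficient
    obtain ⟨S, hS⟩ := Polynomial.pow_rootMultiplicity_dvd W α
    have hSα : S.eval α ≠ 0 := by
      intro h0
      have hd : (Polynomial.X - Polynomial.C α) ∣ S := Polynomial.dvd_iff_isRoot.mpr h0
      obtain ⟨S', hS'⟩ := hd
      have : (Polynomial.X - Polynomial.C α) ^ (j + 1) ∣ W := by
        rw [hS, hS', ← mul_assoc, ← pow_succ]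
        exact dvd_mul_right _ _
      rw [← Polynomial.le_rootMultiplicity_iff hW] at this
      omega
    have h1 : Polynomial.taylor α W = Polynomial.X ^ j * Polynomial.taylor α S := by
      conv_lhs => rw [hS]
      rw [Polynomial.taylor_mul, Polynomial.taylor_pow]
      simp [hj]
    rw [h1]
    have := Polynomial.coeff_X_pow_mul (Polynomial.taylor α S) j 0
    rw [zero_add] at this
    rw [this, Polynomial.taylor_coeff_zero]
    exact hSα
  · choose z hz using hintg
    obtain ⟨V, hV⟩ : ∃ V : Polynomial ℤ, V.map (Int.castRingHom ℚ) = W := by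
      have : W ∈ Polynomial.lifts (Int.castRingHom ℚ) := by
        rw [Polynomial.lifts_iff_coeff_lifts]
        intro m
        exact ⟨z m, by simp [hz m]⟩
      exact (Polynomial.mem_lifts _).mp this
    have hV0 : V ≠ 0 := by rintro rfl; simp at hV; exact hW hV.symm
    set l : Polynomial ℤ := Polynomial.C q * Polynomial.X - Polynomial.C p with hl
    have hlp : l.IsPrimitive := by
      intro c hc
      rw [Polynomial.C_dvd_iff_dvd_coeff] at hc
      have h0 := hc 0
      have h1 := hc 1
      simp only [hl, Polynomial.coeff_sub, Polynomial.coeff_C_mul, Polynomial.coeff_X_zero, mul_zero, Polynomial.coeff_C_zero, zero_sub, dvd_neg, Polynomial.coeff_X_one, mul_one, Polynomial.coeff_C_succ, sub_zero] at h0 h1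
      exact hpq.isUnit_of_dvd' h0 h1
    have hmap : l.map (Int.castRingHom ℚ) = Polynomial.C (q : ℚ) * (Polynomial.X - Polynomial.C α) := by
      simp only [hl, Polynomial.map_sub, Polynomial.map_mul, Polynomial.map_C, Polynomial.map_X, mul_sub,
        ← Polynomial.C_mul, hα]
      rw [mul_div_cancel₀ _ hqQ]
      simp
    have hdvd : ∀ t : ℕ, ∀ V : Polynomial ℤ, V ≠ 0 →
        (Polynomial.X - Polynomial.C α) ^ t ∣ V.map (Int.castRingHom ℚ) → l ^ t ∣ V := by
      intro t
      induction t with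
      | zero => intro V _ _; simp
      | succ t ih =>
        intro V hV0 hd
        have h1 : l ∣ V := by
          have hd1 : l.map (Int.castRingHom ℚ) ∣ V.map (Int.castRingHom ℚ) := by
            rw [hmap]
            have hu : IsUnit (Polynomial.C (q : ℚ)) := Polynomial.isUnit_C.mpr (isUnit_iff_ne_zero.mpr hqQ)
            rw [hu.mul_left_dvd]
            exact (dvd_pow_self _ (Nat.succ_ne_zero t)).trans hd
          exact (Polynomial.IsPrimitive.Int.dvd_iff_map_cast_dvd_map_cast l V hlp).mpr hd1
        obtain ⟨V', rfl⟩ := h1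
        rw [pow_succ']
        apply mul_dvd_mul_left
        apply ih V' (right_ne_zero_of_mul hV0)
        rw [Polynomial.map_mul, hmap, pow_succ', mul_assoc, mul_left_comm] at hd
        have h5 := (mul_dvd_mul_iff_left (Polynomial.X_sub_C_ne_zero α)).mp hd
        have hu : IsUnit (Polynomial.C (q : ℚ)) := Polynomial.isUnit_C.mpr (isUnit_iff_ne_zero.mpr hqQ)
        rwa [hu.dvd_mul_left] at h5
    obtain ⟨S, hS⟩ := hdvd j V hV0 (by rw [hV]; exact Polynomial.pow_rootMultiplicity_dvd W α)
    have hS0 : S ≠ 0 := by rintro rfl; simp at hS; exact hV0 hS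
    have htr : V.trailingCoeff = (-p) ^ j * S.trailingCoeff := by
      have hlt : l.trailingCoeff = -p := by
        have : l.coeff 0 = -p := by simp [hl]
        rw [← this]
        apply Polynomial.trailingCoeff_eq_coeff_zero
        rw [this]; exact neg_ne_zero.mpr hp
      have hpow : ∀ t : ℕ, (l ^ t).trailingCoeff = l.trailingCoeff ^ t := by
        intro t
        induction t with
        | zero => simp [Polynomial.trailingCoeff]
        | succ t ih => rw [pow_succ, Polynomial.trailingCoeff_mul, ih, pow_succ]
      rw [hS, Polynomial.trailingCoeff_mul, hpow, hlt]
    have hst : S.trailingCoeff ≠ 0 := Polynomial.trailingCoeff_nonzero_iff_nonzero.mpr hS0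
    have h1 : |p| ^ j ≤ |V.trailingCoeff| := by
      rw [htr, abs_mul, abs_pow, abs_neg]
      have : 1 ≤ |S.trailingCoeff| := Int.one_le_abs hst
      have h3 : 0 ≤ |p| ^ j := by positivity
      nlinarith
    have h2 := hB V.natTrailingDegree
    rw [← hV, Polynomial.coeff_map] at h2
    have h3 : |((V.trailingCoeff : ℤ) : ℝ)| ≤ B := by
      simpa [Polynomial.trailingCoeff] using h2
    refine le_trans ?_ h3
    exact_mod_cast h1

end RothAux
end

section
open MvPolynomial

namespace RothAux

/-- The weight homomorphism attached to a vector of weights. -/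
noncomputable def wt {n : ℕ} (w : Fin n → ℝ) : (Fin n →₀ ℕ) →+ ℝ where
  toFun J := ∑ i, w i * J i
  map_zero' := by simp
  map_add' J K := by
    rw [← Finset.sum_add_distrib]
    apply Finset.sum_congr rfl
    intro i _
    rw [Finsupp.add_apply]
    push_cast; ring

theorem wt_apply {n : ℕ} (w : Fin n → ℝ) (J : Fin n →₀ ℕ) : wt w J = ∑ i, w i * J i := rfl

theorem wt_single {n : ℕ} (w : Fin n → ℝ) (i : Fin n) : wt w (Finsupp.single i 1) = w i := by
  rw [wt_apply, Finset.sum_eq_single i]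
  · simp
  · intro j _ hj
    simp [Finsupp.single_apply, hj.symm]
  · simp

theorem wt_cnt_le {n : ℕ} (w : Fin (n + 1) → ℝ) {c : ℝ} (hc : ∀ i : Fin n, w i.succ ≤ c)
    (L : List (Fin n)) : wt w (cnt (L.map Fin.succ)) ≤ L.length * c := by
  induction L with
  | nil => simp [cnt]
  | cons i L ih =>
    rw [List.map_cons, cnt, map_add, wt_single, List.length_cons]
    push_cast
    have := hc i
    linarith

theorem wt_cnt_replicate {n : ℕ} (w : Fin (n + 1) → ℝ) (j : ℕ) :
    wt w (cnt (List.replicate j 0)) = j * w 0 := by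
  induction j with
  | zero => simp [cnt]
  | succ j ih =>
    rw [List.replicate_succ, cnt, map_add, wt_single, ih]
    push_cast; ring

theorem wt_cons {n : ℕ} (w : Fin (n + 1) → ℝ) (J : Fin n →₀ ℕ) (j : ℕ) :
    wt w (J.cons j) = w 0 * j + ∑ i : Fin n, w i.succ * J i := by
  rw [wt_apply, Fin.sum_univ_succ]
  simp

theorem cnt_cons {n : ℕ} (L : List (Fin n)) (j : ℕ) :
    cnt (L.map Fin.succ ++ List.replicate j 0) = (cnt L).cons j := by
  induction L with
  | nil =>
    simp only [List.map_nil, List.nil_append, cnt]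
    induction j with
    | zero => simp [cnt]
    | succ j ih =>
      rw [List.replicate_succ, cnt, ih]
      ext i
      refine Fin.cases ?_ (fun i => ?_) i
      · simp; ring
      · simp
  | cons i L ih =>
    rw [List.map_cons, List.cons_append, cnt, ih, cnt]
    ext t
    refine Fin.cases ?_ (fun t => ?_) t
    · simp
    · simp [Finsupp.single_apply]

theorem Deg_iff {n : ℕ} {r : Fin n → ℕ} {P : MvPolynomial (Fin n) ℚ} :
    Deg r P ↔ ∀ i, Ord (wt (Pi.single i (-1))) (-(r i : ℝ)) P := by
  have h : ∀ (J : Fin n →₀ ℕ) i, wt (Pi.single i (-1)) J = -(J i : ℝ) := by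
    intro J i
    rw [wt_apply, Finset.sum_eq_single i]
    · simp
    · intro j _ hj
      simp [hj]
    · simp
  constructor
  · intro hd i J hJ
    rw [h]
    have : (J i : ℝ) ≤ r i := by exact_mod_cast hd J hJ i
    linarith
  · intro ho J hJ i
    have := ho i J hJ
    rw [h] at this
    have h2 : (J i : ℝ) ≤ r i := by linarith
    exact_mod_cast h2

theorem Deg_det {n k : ℕ} {r : Fin n → ℕ}
    {M : Matrix (Fin k) (Fin k) (MvPolynomial (Fin n) ℚ)} (h : ∀ i j, Deg r (M i j)) :
    Deg (fun i => k * r i) M.det := by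
  rw [Deg_iff]
  intro t
  have := Ord.det (a := fun _ => -(r t : ℝ)) (fun i j => Deg_iff.mp (h i j) t)
  refine this.mono ?_
  simp

theorem one_le_l1 {n : ℕ} {P : MvPolynomial (Fin n) ℚ} (h : P ≠ 0) (hi : P ∈ IntP n) : 1 ≤ l1 P := by
  obtain ⟨J, hJ⟩ := MvPolynomial.ne_zero_iff.mp h
  refine le_trans ?_ (coeff_le_l1 P J)
  obtain ⟨z, hz⟩ := mem_IntP.mp hi J
  rw [hz] at hJ ⊢
  have hz0 : z ≠ 0 := by exact_mod_cast hJ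
  have := Int.one_le_abs hz0
  rw [Rat.cast_intCast]
  exact_mod_cast this

theorem sum_max_lower {k R : ℕ} (hk : 0 < k) (hR : 0 < R) (hkR : k ≤ R + 1) {a : ℝ} (ha : 0 ≤ a)
    (ha1 : a ≤ 1) : (k : ℝ) * a ^ 2 / 8 ≤ ∑ j : Fin k, max 0 (a - (j : ℕ) / (R : ℝ)) := by
  set c := ⌈(k : ℝ) * a / 4⌉₊ with hc
  have hkpos : (1 : ℝ) ≤ k := by exact_mod_cast hk
  have hck : c ≤ k := by
    rw [hc, Nat.ceil_le]
    nlinarith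
  rw [← Finset.sum_range (fun j => max 0 (a - (j : ℝ) / (R : ℝ)))]
  have h1 : ∑ j ∈ Finset.range c, a / 2 ≤ ∑ j ∈ Finset.range k, max 0 (a - (j : ℝ) / (R : ℝ)) := by
    refine le_trans (Finset.sum_le_sum ?_) (Finset.sum_le_sum_of_subset_of_nonneg
      (Finset.range_mono hck) (fun _ _ _ => le_max_left _ _))
    intro j hj
    refine le_trans ?_ (le_max_right _ _)
    have hj1 : (j : ℝ) < k * a / 4 := by
      rw [Finset.mem_range, hc, Nat.lt_ceil] at hj
      exact hj
    have hR1 : (1 : ℝ) ≤ R := by exact_mod_cast hR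
    have hkR' : (k : ℝ) ≤ R + 1 := by exact_mod_cast hkR
    have : (j : ℝ) / R ≤ a / 2 := by
      rw [div_le_iff₀ (by linarith)]
      nlinarith
    linarith
  refine le_trans ?_ h1
  rw [Finset.sum_const, Finset.card_range, nsmul_eq_mul]
  have : (k : ℝ) * a / 4 ≤ c := Nat.le_ceil _
  nlinarith

theorem log_factorial_le (k R : ℕ) (hk : 0 < k) (h : k ≤ R + 1) :
    Real.log (k.factorial : ℝ) ≤ k * R := by
  have h1 : (k.factorial : ℝ) ≤ (k : ℝ) ^ k := by exact_mod_cast Nat.factorial_le_pow k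
  have h0 : (0 : ℝ) < k.factorial := by exact_mod_cast Nat.factorial_pos k
  have h2 := Real.log_le_log h0 h1
  rw [Real.log_pow] at h2
  refine h2.trans ?_
  apply mul_le_mul_of_nonneg_left _ (by positivity)
  have hk' : (0 : ℝ) < k := by exact_mod_cast hk
  have := Real.log_le_sub_one_of_pos hk'
  have h3 : (k : ℝ) ≤ R + 1 := by exact_mod_cast h
  linarith

/-- Statement of Roth's lemma in `n` variables. -/
def RothStmt (n : ℕ) : Prop := ∀ η : ℝ, 0 < η → ∃ ω : ℝ, 0 < ω ∧
  ∀ (r : Fin n → ℕ) (p q : Fin n → ℤ) (P : MvPolynomial (Fin n) ℚ),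
    (∀ i, 0 < r i) → (∀ i j, i < j → (r i : ℝ) ≤ ω * r j) →
    (∀ i, p i ≠ 0) → (∀ i, q i ≠ 0) → (∀ i, IsCoprime (p i) (q i)) →
    P ≠ 0 → P ∈ IntP n → Deg r P →
    (∀ i, Real.log (l1 P) + ∑ j, (r j : ℝ) ≤ ω * (r i * Real.log |(p i : ℝ)|)) →
    ∃ J, coeff J (T (fun i => (p i : ℚ) / q i) P) ≠ 0 ∧ ∑ i, (r i : ℝ)⁻¹ * J i ≤ η

theorem roth_zero : RothStmt 0 := by
  intro η hη
  refine ⟨1, one_pos, ?_⟩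
  intro r p q P _ _ _ _ _ hP _ _ _
  obtain ⟨J, hJ⟩ := MvPolynomial.ne_zero_iff.mp (T_ne_zero (fun i => (p i : ℚ) / q i) hP)
  exact ⟨J, hJ, by simpa using hη.le⟩

set_option maxHeartbeats 2000000 in
theorem roth_succ (n : ℕ) (ih : RothStmt n) : RothStmt (n + 1) := by
  intro η0 hη0
  set η := min η0 1 with hηdef
  have hη : 0 < η := lt_min hη0 one_pos
  have hη1 : η ≤ 1 := min_le_right _ _
  obtain ⟨ω', hω', hind⟩ := ih (η ^ 2 / 100) (by positivity)
  set ω := min (ω' / 3) (η ^ 2 / 200) with hωdef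
  have hω : 0 < ω := lt_min (by positivity) (by positivity)
  have hωa : ω ≤ ω' / 3 := min_le_left _ _
  have hωb : ω ≤ η ^ 2 / 200 := min_le_right _ _
  refine ⟨ω, hω, ?_⟩
  intro r p q P hr hrr hp hq hpq hP hPi hPd hlog
  set α : Fin (n + 1) → ℚ := fun i => (p i : ℚ) / q i with hα
  by_contra hcon
  push Not at hcon
  set φ := wt (fun i => ((r i : ℝ))⁻¹) with hφ
  have hφ0 : ∀ J, 0 ≤ φ J := by
    intro J
    rw [hφ, wt_apply]
    exact Finset.sum_nonneg fun i _ => by positivity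
  have hord : Ord φ η (T α P) := by
    intro J hJ
    have := hcon J hJ
    exact (min_le_left _ _).trans this.le
  obtain ⟨k, hk0, hkr, f, g, hf, hg, hPfg⟩ := exists_decomp hP hPd
  obtain ⟨L, hL, hdetL⟩ := genW_mv f hf
  obtain ⟨e, he, hdete⟩ := genW_poly g hg
  set A : Matrix (Fin k) (Fin k) (MvPolynomial (Fin n) ℚ) :=
    Matrix.of fun i l => nd (L i) (f l) with hA
  set B : Matrix (Fin k) (Fin k) (Polynomial ℚ) :=
    Matrix.of fun l j => ((e j : ℕ).factorial : ℚ)⁻¹ • Polynomial.derivative^[(e j : ℕ)] (g l) with hB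
  set M : Matrix (Fin k) (Fin k) (MvPolynomial (Fin (n + 1)) ℚ) :=
    Matrix.of fun i j => nd ((L i).map Fin.succ ++ List.replicate (e j : ℕ) 0) P with hM
  have hA0 : A.det ≠ 0 := by
    have h1 : A = Matrix.of fun i l => (C (∏ t, ((cnt (L i) t).factorial : ℚ))⁻¹) *
        (Matrix.of fun i j => pd (L i) (f j)) i l := by
      ext i l : 2
      simp only [hA, Matrix.of_apply, nd, smul_eq_C_mul]
    rw [h1, Matrix.det_mul_column]
    refine mul_ne_zero (Finset.prod_ne_zero_iff.mpr fun i _ => ?_) hdetL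
    rw [Ne, C_eq_zero]
    exact inv_ne_zero (Finset.prod_ne_zero_iff.mpr fun i _ => by positivity)
  have hB0 : B.det ≠ 0 := by
    have h1 : B = Matrix.of fun l j => (Polynomial.C (((e j : ℕ).factorial : ℚ)⁻¹)) *
        (Matrix.of fun i j => (Polynomial.derivative^[(e i : ℕ)] (g j))).transpose l j := by
      ext l j : 2
      simp only [hB, Matrix.of_apply, Matrix.transpose_apply, Polynomial.smul_eq_C_mul]
    rw [h1, Matrix.det_mul_row, Matrix.det_transpose]
    refine mul_ne_zero (Finset.prod_ne_zero_iff.mpr fun i _ => ?_) hdete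
    rw [Ne, Polynomial.C_eq_zero]
    exact inv_ne_zero (by positivity)
  have hMAB : M = A.map io * B.map ps := by
    refine Matrix.ext fun i j => ?_
    rw [Matrix.mul_apply]
    simp only [hM, hA, hB, Matrix.of_apply, Matrix.map_apply]
    have h1 : pd ((L i).map Fin.succ ++ List.replicate (e j : ℕ) 0) P =
        ∑ l, io (pd (L i) (f l)) * ps (Polynomial.derivative^[(e j : ℕ)] (g l)) := by
      have h2 := pd_sum Finset.univ ((L i).map Fin.succ ++ List.replicate (e j : ℕ) 0)
        (fun _ => 1) (fun l => io (f l) * ps (g l))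
      simp only [one_smul] at h2
      rw [← hPfg] at h2
      rw [h2]
      apply Finset.sum_congr rfl
      intro l _
      exact pd_io_ps _ _ _ _
    rw [nd, h1, cnt_cons, Finset.smul_sum]
    apply Finset.sum_congr rfl
    intro l _
    rw [nd, map_smul, map_smul, smul_mul_smul_comm]
    congr 1
    rw [Fin.prod_univ_succ, mul_inv, mul_comm]
    simp
  set V := M.det with hV
  set U := A.det with hU
  set W := B.det with hW
  have hVUW : V = io U * ps W := by
    rw [hV, hMAB, Matrix.det_mul, hU, hW, AlgHom.map_det, AlgHom.map_det]
    rfl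
  have hVi : V ∈ IntP (n + 1) := det_IntP fun i j => nd_IntP _ hPi
  have hVd : Deg (fun i => k * r i) V := Deg_det fun i j => nd_Deg _ hPd
  have hcoef : ∀ J j, coeff (J.cons j) V = coeff J U * W.coeff j := by
    intro J j; rw [hVUW, coeff_io_ps]
  obtain ⟨I0, hI0⟩ := MvPolynomial.ne_zero_iff.mp hA0
  obtain ⟨j0, hj0⟩ : ∃ j0, W.coeff j0 ≠ 0 := by
    by_contra h
    push Not at h
    exact hB0 (Polynomial.ext (by simpa using h))
  have hV0 : V ≠ 0 := by
    apply MvPolynomial.ne_zero_iff.mpr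
    exact ⟨I0.cons j0, by rw [hcoef]; exact mul_ne_zero hI0 hj0⟩
  -- size estimates
  have hP1 : 1 ≤ l1 P := one_le_l1 hP hPi
  have hV1 : 1 ≤ l1 V := one_le_l1 hV0 hVi
  set s : ℝ := ∑ j, (r j : ℝ) with hs
  set E : ℝ := Real.log (l1 P) + s with hE
  have hlogP : 0 ≤ Real.log (l1 P) := Real.log_nonneg hP1
  have hr0s : (r 0 : ℝ) ≤ s :=
    Finset.single_le_sum (f := fun j => (r j : ℝ)) (fun _ _ => by positivity) (Finset.mem_univ 0)
  have hr01 : (1 : ℝ) ≤ r 0 := by exact_mod_cast hr 0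
  have hkpos : (1 : ℝ) ≤ k := by exact_mod_cast hk0
  have hlogV : Real.log (l1 V) ≤ k * (2 * s + Real.log (l1 P)) := by
    have h1 : l1 V ≤ k.factorial * (2 ^ (∑ i, r i) * l1 P) ^ k :=
      l1_det fun i j => l1_nd _ hPd
    have h2 := Real.log_le_log (by linarith) h1
    rw [Real.log_mul (by positivity) (by positivity), Real.log_pow,
      Real.log_mul (by positivity) (by positivity), Real.log_pow] at h2
    have h3 := log_factorial_le k (r 0) hk0 hkr
    have h4 : Real.log 2 ≤ 1 := by linarith [Real.log_two_lt_d9]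
    have h5 : ((∑ i, r i : ℕ) : ℝ) = s := by rw [hs]; push_cast; rfl
    rw [h5] at h2
    have hs0 : 0 ≤ s := by linarith
    have h6 : s * Real.log 2 ≤ s := by nlinarith
    have h7 : (k : ℝ) * r 0 ≤ k * s := by nlinarith
    have h8 : (k : ℝ) * (s * Real.log 2 + Real.log (l1 P)) ≤ k * (s + Real.log (l1 P)) := by
      apply mul_le_mul_of_nonneg_left _ (by linarith)
      linarith
    nlinarith
  -- the factor in the last variables
  have hU' : ∃ J, coeff J (T (fun i : Fin n => α i.succ) U) ≠ 0 ∧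
      ∑ i : Fin n, ((r i.succ : ℝ))⁻¹ * J i ≤ k * (η ^ 2 / 100) := by
    have hcU : ∀ J, coeff J (W.coeff j0 • U) = coeff (J.cons j0) V := by
      intro J; rw [hcoef, coeff_smul, smul_eq_mul, mul_comm]
    have hne : W.coeff j0 • U ≠ 0 := smul_ne_zero hj0 hA0
    have hintg : W.coeff j0 • U ∈ IntP n := by
      rw [mem_IntP]
      intro J
      rw [hcU]
      exact mem_IntP.mp hVi _
    have hl : l1 (W.coeff j0 • U) ≤ l1 V := by
      have := l1_le_of_inj (Q := W.coeff j0 • U) (P := V) (fun J => J.cons j0)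
        (fun x y hxy => by
          have := congrArg Finsupp.tail hxy
          simpa using this) (c := 1) zero_le_one (by
        intro J _
        rw [hcU, one_mul])
      simpa using this
    obtain ⟨J, hJ, hJw⟩ := hind (fun i => k * r i.succ) (fun i => p i.succ) (fun i => q i.succ)
      (W.coeff j0 • U) (fun i => Nat.mul_pos hk0 (hr _)) (by
        intro i j hij
        have h1 := hrr i.succ j.succ (Fin.succ_lt_succ_iff.mpr hij)
        have h2 : (0 : ℝ) ≤ r j.succ := by positivity
        have h3 : (r i.succ : ℝ) ≤ ω' * r j.succ := by nlinarith
        push_cast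
        nlinarith) (fun i => hp _) (fun i => hq _) (fun i => hpq _) hne hintg (by
        intro J hJ i
        rw [hcU] at hJ
        simpa using hVd _ hJ i.succ) (by
        intro i
        have h1 := hlog i.succ
        have h2 : Real.log (l1 (W.coeff j0 • U)) ≤ Real.log (l1 V) :=
          Real.log_le_log (by linarith [one_le_l1 hne hintg]) hl
        have h3 : ∑ j : Fin n, ((k * r j.succ : ℕ) : ℝ) ≤ k * s := by
          push_cast
          rw [← Finset.mul_sum, hs, Fin.sum_univ_succ]
          apply mul_le_mul_of_nonneg_left _ (by linarith)
          linarith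
        have h4 : Real.log (l1 (W.coeff j0 • U)) + ∑ j : Fin n, ((k * r j.succ : ℕ) : ℝ) ≤
            k * (3 * E) := by
          refine (add_le_add (h2.trans hlogV) h3).trans ?_
          rw [hE]
          nlinarith
        refine h4.trans ?_
        have h5 : 0 ≤ (r i.succ : ℝ) * Real.log |(p i.succ : ℝ)| := by
          have : 0 ≤ E := by rw [hE]; linarith
          by_contra hneg
          push Not at hneg
          have := mul_neg_of_pos_of_neg hω hneg
          linarith
        have h6 : 3 * E ≤ ω' * (r i.succ * Real.log |(p i.succ : ℝ)|) := by
          have : 3 * ω ≤ ω' := by linarith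
          nlinarith
        push_cast
        nlinarith)
    refine ⟨J, ?_, ?_⟩
    · rw [map_smul, coeff_smul] at hJ
      exact right_ne_zero_of_smul hJ
    · have h1 : ∑ i : Fin n, ((r i.succ : ℝ))⁻¹ * J i =
          k * ∑ i : Fin n, (((k * r i.succ : ℕ) : ℝ))⁻¹ * J i := by
        rw [Finset.mul_sum]
        apply Finset.sum_congr rfl
        intro i _
        have : (k : ℝ) ≠ 0 := by positivity
        push_cast
        rw [mul_inv, ← mul_assoc, ← mul_assoc, mul_inv_cancel₀ this, one_mul]
      rw [h1]
      exact mul_le_mul_of_nonneg_left hJw (by linarith)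
  -- the factor in the first variable
  have hW' : ∃ j, (Polynomial.taylor (α 0) W).coeff j ≠ 0 ∧ (j : ℝ) ≤ 2 * k * ω * r 0 := by
    have hcW : ∀ j, (coeff I0 U • W).coeff j = coeff (I0.cons j) V := by
      intro j; rw [hcoef, Polynomial.coeff_smul, smul_eq_mul]
    obtain ⟨j, hj, hjB⟩ := univ_index (W := coeff I0 U • W) (B := l1 V) (smul_ne_zero hI0 hB0)
      (fun j => by rw [hcW]; exact mem_IntP.mp hVi _)
      (fun j => by rw [hcW]; exact coeff_le_l1 _ _) (hp 0) (hq 0) (hpq 0)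
    refine ⟨j, ?_, ?_⟩
    · rw [map_smul, Polynomial.coeff_smul] at hj
      exact right_ne_zero_of_smul hj
    · have hp0 : 0 < |(p 0 : ℝ)| := abs_pos.mpr (by exact_mod_cast hp 0)
      have h1 := Real.log_le_log (by positivity) hjB
      rw [Real.log_pow] at h1
      have h2 := hlog 0
      have hEpos : 0 < E := by rw [hE]; linarith
      have hlp : 0 < Real.log |(p 0 : ℝ)| := by
        by_contra hneg
        push Not at hneg
        have : ω * (r 0 * Real.log |(p 0 : ℝ)|) ≤ 0 :=
          mul_nonpos_of_nonneg_of_nonpos hω.le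
            (mul_nonpos_of_nonneg_of_nonpos (by positivity) hneg)
        linarith
      have h3 : Real.log (l1 V) ≤ k * (2 * E) := by
        refine hlogV.trans ?_
        apply mul_le_mul_of_nonneg_left _ (by linarith)
        rw [hE]; linarith
      have h4 : (j : ℝ) * Real.log |(p 0 : ℝ)| ≤ (2 * k * ω * r 0) * Real.log |(p 0 : ℝ)| := by
        refine h1.trans (h3.trans ?_)
        have : (k : ℝ) * (2 * E) ≤ k * (2 * (ω * (r 0 * Real.log |(p 0 : ℝ)|))) := by
          apply mul_le_mul_of_nonneg_left _ (by linarith)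
          linarith
        linarith
      exact le_of_mul_le_mul_right h4 hlp
  obtain ⟨J, hJ, hJw⟩ := hU'
  obtain ⟨j, hj, hjw⟩ := hW'
  -- lower bound for the index of V
  have hωη : ω ≤ η / 2 := by nlinarith
  have hordV : Ord φ (∑ j : Fin k, max 0 ((η - ω) - ((e j : ℕ) : ℝ) / (r 0 : ℝ))) (T α V) := by
    have h1 : T α V = (M.map (T α)).det := by
      rw [hV, AlgHom.map_det]; rfl
    rw [h1]
    apply Ord.det
    intro i j
    have h2 : (M.map (T α)) i j =
        nd ((L i).map Fin.succ ++ List.replicate (e j : ℕ) 0) (T α P) := by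
      simp only [Matrix.map_apply, hM, Matrix.of_apply, T_nd]
    rw [h2]
    have h3 := Ord_nd ((L i).map Fin.succ ++ List.replicate (e j : ℕ) 0) hord
    intro K hK
    apply max_le (hφ0 K)
    refine le_trans ?_ (h3 K hK)
    rw [cnt_append, map_add, hφ, wt_cnt_replicate]
    have h4 : wt (fun i => ((r i : ℝ))⁻¹) (cnt ((L i).map Fin.succ)) ≤ (L i).length * (ω / r 0) := by
      apply wt_cnt_le
      intro t
      have h5 := hrr 0 t.succ (Fin.succ_pos t)
      have h6 : (0 : ℝ) < r t.succ := by exact_mod_cast hr t.succ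
      rw [inv_eq_one_div, div_le_div_iff₀ h6 (by linarith)]
      linarith
    have h7 : ((L i).length : ℝ) * (ω / r 0) ≤ ω := by
      have h8 : ((L i).length : ℝ) ≤ r 0 := by
        have := hL i
        have h9 : (L i).length ≤ r 0 := by omega
        exact_mod_cast h9
      rw [mul_div_assoc', div_le_iff₀ (by linarith)]
      nlinarith
    rw [div_eq_mul_inv]
    linarith
  have hfin := hordV (J.cons j) (by
    rw [hVUW, map_mul, T_io, T_ps, coeff_io_ps]
    exact mul_ne_zero hJ hj)
  rw [hφ, wt_cons] at hfin
  have hsum : ∑ j : Fin k, max 0 ((η - ω) - ((e j : ℕ) : ℝ) / (r 0 : ℝ)) =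
      ∑ j : Fin k, max 0 ((η - ω) - ((j : ℕ) : ℝ) / (r 0 : ℝ)) :=
    he.sum_comp (fun j : Fin k => max 0 ((η - ω) - ((j : ℕ) : ℝ) / (r 0 : ℝ)))
  rw [hsum] at hfin
  have hlow := sum_max_lower hk0 (hr 0) hkr (a := η - ω) (by linarith) (by linarith)
  have hj2 : ((r 0 : ℝ))⁻¹ * j ≤ 2 * k * ω := by
    rw [inv_mul_le_iff₀ (by linarith)]
    linarith
  have h1 : (k : ℝ) * (η - ω) ^ 2 / 8 ≤ 2 * k * ω + k * (η ^ 2 / 100) := by linarith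
  have h2 : (η - ω) ^ 2 / 8 ≤ 2 * ω + (η ^ 2 / 100) := by
    have hk' : (0 : ℝ) < k := by linarith
    refine le_of_mul_le_mul_left ?_ hk'
    linarith
  have h3 : η / 2 ≤ η - ω := by linarith
  have h4 : (η / 2) ^ 2 ≤ (η - ω) ^ 2 := by
    apply pow_le_pow_left₀ (by positivity) h3
  nlinarith

theorem roth (n : ℕ) : RothStmt n := by
  induction n with
  | zero => exact roth_zero
  | succ n ih => exact roth_succ n ih

end RothAux
end

section
open MvPolynomial

namespace RothAux

theorem coeff_T_monomial {n : ℕ} : ∀ (β : Fin n → ℚ) (a j : Fin n →₀ ℕ),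
    coeff j (T β (monomial a 1)) = ∏ i, ((a i).choose (j i) : ℚ) * β i ^ (a i - j i) := by
  induction n with
  | zero =>
    intro β a j
    have ha : a = 0 := Subsingleton.elim _ _
    have hj : j = 0 := Subsingleton.elim _ _
    subst ha; subst hj
    have : (monomial (0 : Fin 0 →₀ ℕ)) (1 : ℚ) = 1 := rfl
    rw [this, map_one]; simp
  | succ n ih =>
    intro β a j
    obtain ⟨a0, a', rfl⟩ : ∃ a0 a', a = Finsupp.cons a0 a' :=
      ⟨a 0, a.tail, (Finsupp.cons_tail a).symm⟩
    obtain ⟨j0, j', rfl⟩ : ∃ a0 a', j = Finsupp.cons a0 a' :=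
      ⟨j 0, j.tail, (Finsupp.cons_tail j).symm⟩
    have h1 : monomial (Finsupp.cons a0 a') (1 : ℚ) =
        io (monomial a' 1) * ps (Polynomial.X ^ a0) := by
      ext K
      obtain ⟨k0, k', rfl⟩ : ∃ a0 a', K = Finsupp.cons a0 a' :=
        ⟨K 0, K.tail, (Finsupp.cons_tail K).symm⟩
      rw [coeff_io_ps, coeff_monomial, coeff_monomial, Polynomial.coeff_X_pow]
      by_cases h0 : a0 = k0
      · by_cases h' : a' = k'
        · subst h0; subst h'; simp
        · rw [if_neg h', if_neg, zero_mul]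
          intro h
          apply h'
          have := congrArg Finsupp.tail h
          simpa using this
      · rw [if_neg (Ne.symm h0), if_neg, mul_zero]
        intro h
        apply h0
        have := DFunLike.congr_fun h 0
        simpa using this
    rw [h1, map_mul, T_io, T_ps, coeff_io_ps, ih, Fin.prod_univ_succ]
    have h2 : Polynomial.taylor (β 0) (Polynomial.X ^ a0 : Polynomial ℚ) =
        (Polynomial.X + Polynomial.C (β 0)) ^ a0 := by
      simp
    rw [h2, Polynomial.coeff_X_add_C_pow]
    simp only [Finsupp.cons_zero, Finsupp.cons_succ]
    ring

/-- The box of exponents. -/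
abbrev Bx {m : ℕ} (r : Fin m → ℕ) := (i : Fin m) → Fin (r i + 1)

/-- The exponent attached to a point of the box. -/
noncomputable def em {m : ℕ} {r : Fin m → ℕ} (a : Bx r) : Fin m →₀ ℕ :=
  Finsupp.equivFunOnFinite.symm (fun i => (a i : ℕ))

@[simp] theorem em_apply {m : ℕ} {r : Fin m → ℕ} (a : Bx r) (i : Fin m) : em a i = (a i : ℕ) := rfl

theorem em_inj {m : ℕ} {r : Fin m → ℕ} : Function.Injective (em (r := r)) := by
  intro a b h
  funext i
  have := DFunLike.congr_fun h i
  exact Fin.ext this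

theorem em_surj {m : ℕ} {r : Fin m → ℕ} (J : Fin m →₀ ℕ) (h : ∀ i, J i ≤ r i) :
    ∃ a : Bx r, em a = J := by
  refine ⟨fun i => ⟨J i, Nat.lt_succ_of_le (h i)⟩, ?_⟩
  ext i; rfl

theorem coeff_T {m : ℕ} {r : Fin m → ℕ} (β : Fin m → ℚ) {P : MvPolynomial (Fin m) ℚ}
    (hP : Deg r P) (j : Fin m →₀ ℕ) :
    coeff j (T β P) = ∑ a : Bx r, coeff (em a) P *
      ∏ i, ((a i : ℕ).choose (j i) : ℚ) * β i ^ ((a i : ℕ) - j i) := by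
  classical
  have h1 : P = ∑ a : Bx r, coeff (em a) P • monomial (em a) 1 := by
    ext J
    rw [coeff_sum]
    simp only [coeff_smul, coeff_monomial, smul_eq_mul]
    by_cases hJ : ∀ i, J i ≤ r i
    · obtain ⟨b, rfl⟩ := em_surj J hJ
      rw [Finset.sum_eq_single b]
      · simp
      · intro c _ hc
        rw [if_neg, mul_zero]
        exact fun h => hc (em_inj h)
      · simp
    · have : coeff J P = 0 := by
        by_contra hne
        exact hJ (hP J hne)
      rw [this]
      symm
      apply Finset.sum_eq_zero
      intro c _
      rw [if_neg, mul_zero]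
      rintro rfl
      exact hJ fun i => Nat.lt_succ_iff.mp (c i).2
  conv_lhs => rw [h1]
  rw [map_sum, coeff_sum]
  apply Finset.sum_congr rfl
  intro a _
  rw [map_smul, coeff_smul, smul_eq_mul, coeff_T_monomial]
  rfl

/-- Flipping one coordinate of the box. -/
def flip {m : ℕ} (r : Fin m → ℕ) (i : Fin m) : Bx r ≃ Bx r where
  toFun a := Function.update a i (Fin.rev (a i))
  invFun a := Function.update a i (Fin.rev (a i))
  left_inv a := by simp
  right_inv a := by simp

/-- Second-moment bound on the box. -/
theorem second_moment {m : ℕ} (r : Fin m → ℕ) (w : Fin m → ℝ) (M : ℝ)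
    (h : ∀ i, |w i| * r i ≤ M) :
    ∑ a : Bx r, (∑ i, w i * ((a i : ℕ) - (r i : ℝ) / 2)) ^ 2 ≤
      m * (M ^ 2 / 4) * Fintype.card (Bx r) := by
  set Y : Bx r → Fin m → ℝ := fun a i => w i * ((a i : ℕ) - (r i : ℝ) / 2) with hY
  have hcross : ∀ i j, i ≠ j → ∑ a : Bx r, Y a i * Y a j = 0 := by
    intro i j hij
    have h1 := Equiv.sum_comp (flip r i) (fun a => Y a i * Y a j)
    have h2 : ∀ a, Y (flip r i a) i * Y (flip r i a) j = - (Y a i * Y a j) := by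
      intro a
      have e1 : (flip r i a) i = Fin.rev (a i) := by simp [flip]
      have e2 : (flip r i a) j = a j := by simp [flip, hij.symm]
      simp only [hY]
      rw [e1, e2, Fin.val_rev]
      have : (a i : ℕ) + 1 ≤ r i + 1 := (a i).2
      rw [Nat.cast_sub this]
      push_cast
      ring
    simp only [h2] at h1
    rw [Finset.sum_neg_distrib] at h1
    linarith
  have hdiag : ∀ a i, Y a i * Y a i ≤ M ^ 2 / 4 := by
    intro a i
    have h1 : |Y a i| ≤ M / 2 := by
      simp only [hY]
      rw [abs_mul]
      have h2 : |((a i : ℕ) : ℝ) - (r i : ℝ) / 2| ≤ r i / 2 := by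
        have : ((a i : ℕ) : ℝ) ≤ r i := by exact_mod_cast Nat.lt_succ_iff.mp (a i).2
        have h0 : (0 : ℝ) ≤ (a i : ℕ) := by positivity
        rw [abs_le]; constructor <;> linarith
      have := mul_le_mul_of_nonneg_left h2 (abs_nonneg (w i))
      linarith [h i]
    have h3 := abs_nonneg (Y a i)
    rw [← abs_mul_abs_self]
    nlinarith
  have h1 : ∀ a, (∑ i, Y a i) ^ 2 = ∑ i, ∑ j, Y a i * Y a j := by
    intro a; rw [sq, Finset.sum_mul_sum]
  have h2 : ∑ a : Bx r, (∑ i, Y a i) ^ 2 = ∑ i, ∑ j, ∑ a, Y a i * Y a j := by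
    simp only [h1]
    rw [Finset.sum_comm]
    apply Finset.sum_congr rfl
    intro i _
    rw [Finset.sum_comm]
  rw [h2]
  have h3 : ∀ i, ∑ j, ∑ a : Bx r, Y a i * Y a j ≤ M ^ 2 / 4 * Fintype.card (Bx r) := by
    intro i
    rw [Finset.sum_eq_single i (fun j _ hj => hcross i j hj.symm) (by simp)]
    refine (Finset.sum_le_sum fun a _ => hdiag a i).trans ?_
    rw [Finset.sum_const, nsmul_eq_mul, Finset.card_univ, mul_comm]
  refine (Finset.sum_le_sum fun i _ => h3 i).trans ?_
  rw [Finset.sum_const, nsmul_eq_mul, Finset.card_univ, Fintype.card_fin, mul_assoc]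

theorem cheb {m : ℕ} (r : Fin m → ℕ) (w : Fin m → ℝ) (M D : ℝ) (hD : 0 < D)
    (h : ∀ i, |w i| * r i ≤ M) (hMD : m * M ^ 2 ≤ D ^ 2)
    (S : Finset (Bx r)) (hS : ∀ a ∈ S, D ≤ |∑ i, w i * ((a i : ℕ) - (r i : ℝ) / 2)|) :
    4 * (S.card : ℝ) ≤ Fintype.card (Bx r) := by
  have h1 := second_moment r w M h
  have h2 : (S.card : ℝ) * D ^ 2 ≤ ∑ a : Bx r, (∑ i, w i * ((a i : ℕ) - (r i : ℝ) / 2)) ^ 2 := by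
    refine le_trans ?_ (Finset.sum_le_sum_of_subset_of_nonneg (Finset.subset_univ S)
      fun _ _ _ => sq_nonneg _)
    rw [← nsmul_eq_mul]
    apply Finset.card_nsmul_le_sum
    intro a ha
    rw [← sq_abs (∑ i, _)]
    exact pow_le_pow_left₀ hD.le (hS a ha) 2
  have h3 : (4 * (S.card : ℝ)) * D ^ 2 ≤ Fintype.card (Bx r) * D ^ 2 := by
    have : (m : ℝ) * (M ^ 2 / 4) * Fintype.card (Bx r) ≤ D ^ 2 / 4 * Fintype.card (Bx r) := by
      apply mul_le_mul_of_nonneg_right _ (by positivity)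
      linarith
    linarith
  exact le_of_mul_le_mul_right h3 (by positivity)

theorem card_Bx_le {m : ℕ} (r : Fin m → ℕ) : Fintype.card (Bx r) ≤ 2 ^ (∑ i, r i) := by
  rw [Fintype.card_pi, ← Finset.prod_pow_eq_pow_sum]
  apply Finset.prod_le_prod' 
  intro i _
  rw [Fintype.card_fin]
  exact Nat.lt_two_pow_self

theorem prod_choose_le {m : ℕ} (r : Fin m → ℕ) (a : Bx r) (J : Fin m → ℕ) :
    ∏ i, (a i : ℕ).choose (J i) ≤ 2 ^ (∑ i, r i) := by
  rw [← Finset.prod_pow_eq_pow_sum]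
  apply Finset.prod_le_prod' 
  intro i _
  refine (Nat.choose_le_two_pow _ _).trans ?_
  exact Nat.pow_le_pow_right (by norm_num) (Nat.lt_succ_iff.mp (a i).2)

attribute [local instance] Matrix.seminormedAddCommGroup
theorem siegel {m : ℕ} (r : Fin m → ℕ) (S E : Finset (Bx r)) (hSE : 2 * E.card ≤ S.card)
    (hS : 0 < S.card) :
    ∃ c : Bx r → ℤ, c ≠ 0 ∧ (∀ a, a ∉ S → c a = 0) ∧
      (∀ J ∈ E, ∑ a, c a * ∏ i, (((a i : ℕ).choose (J i : ℕ) : ℕ) : ℤ) = 0) ∧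
      ∀ a, |(c a : ℝ)| ≤ 4 ^ (∑ i, r i) := by
  classical
  by_cases hE : E.card = 0
  · obtain ⟨a, ha⟩ := Finset.card_pos.mp hS
    rw [Finset.card_eq_zero] at hE
    refine ⟨Pi.single a 1, by simp, ?_, by simp [hE], ?_⟩
    · intro b hb
      rw [Pi.single_apply, if_neg]
      rintro rfl; exact hb ha
    · intro b
      rw [Pi.single_apply]
      split_ifs
      · simpa using one_le_pow₀ (by norm_num)
      · simp
  · have hE0 : 0 < E.card := Nat.pos_of_ne_zero hE
    let A : Matrix E S ℤ := Matrix.of fun J a => ∏ i, (((a.1 i : ℕ).choose (J.1 i : ℕ) : ℕ) : ℤ)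
    obtain ⟨t, ht0, hAt, ht⟩ := Int.Matrix.exists_ne_zero_int_vec_norm_le A
      (by simp; omega) (by simpa using Finset.card_pos.mp hE0)
    refine ⟨fun a => if h : a ∈ S then t ⟨a, h⟩ else 0, ?_, ?_, ?_, ?_⟩
    · intro h
      apply ht0
      funext ⟨a, ha⟩
      have := congrFun h a
      simpa [ha] using this
    · intro a ha; simp [ha]
    · intro J hJ
      have h1 := congrFun hAt ⟨J, hJ⟩
      simp only [Matrix.mulVec, dotProduct, A, Matrix.of_apply, Pi.zero_apply] at h1
      refine Eq.trans ?_ h1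
      rw [← Finset.sum_subset (Finset.subset_univ S), ← Finset.sum_coe_sort S]
      · apply Finset.sum_congr rfl
        rintro ⟨a, ha⟩ _
        simp [ha, mul_comm]
      · intro a _ ha; simp [ha]
    · have hA : ‖A‖ ≤ 2 ^ (∑ i, r i) := by
        rw [Matrix.norm_le_iff (by positivity)]
        intro J a
        simp only [A, Matrix.of_apply, Int.norm_eq_abs]
        have := prod_choose_le r a.1 (fun i => (J.1 i : ℕ))
        rw [abs_of_nonneg (by positivity)]
        exact_mod_cast this
      have hbase : ((Fintype.card S : ℕ) : ℝ) * max 1 ‖A‖ ≤ 4 ^ (∑ i, r i) := by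
        have h1 : ((Fintype.card S : ℕ) : ℝ) ≤ 2 ^ (∑ i, r i) := by
          have : Fintype.card S ≤ 2 ^ (∑ i, r i) := by
            rw [Fintype.card_coe]
            exact (Finset.card_le_univ S).trans (card_Bx_le r)
          exact_mod_cast this
        have h2 : max 1 ‖A‖ ≤ 2 ^ (∑ i, r i) := max_le (one_le_pow₀ (by norm_num)) hA
        calc _ ≤ (2 : ℝ) ^ (∑ i, r i) * 2 ^ (∑ i, r i) := by gcongr
          _ = 4 ^ (∑ i, r i) := by rw [← mul_pow]; norm_num
      have hb1 : 1 ≤ ((Fintype.card S : ℕ) : ℝ) * max 1 ‖A‖ := by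
        have h1 : (1 : ℝ) ≤ (Fintype.card S : ℕ) := by
          rw [Fintype.card_coe]; exact_mod_cast hS
        have h2 : 1 ≤ max 1 ‖A‖ := le_max_left _ _
        nlinarith
      have hexp : ((Fintype.card E : ℕ) : ℝ) / ((Fintype.card S : ℕ) - (Fintype.card E : ℕ)) ≤ 1 := by
        rw [Fintype.card_coe, Fintype.card_coe]
        have h1 : 2 * (E.card : ℝ) ≤ S.card := by exact_mod_cast hSE
        have h2 : (0 : ℝ) < E.card := by exact_mod_cast hE0
        rw [div_le_one (by linarith)]
        linarith
      have htn : ‖t‖ ≤ 4 ^ (∑ i, r i) := by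
        refine ht.trans (le_trans ?_ hbase)
        calc _ ≤ (((Fintype.card S : ℕ) : ℝ) * max 1 ‖A‖) ^ (1 : ℝ) :=
              Real.rpow_le_rpow_of_exponent_le hb1 hexp
          _ = _ := Real.rpow_one _
      intro a
      by_cases ha : a ∈ S
      · simp only [ha, dite_true]
        have := (norm_le_pi_norm t ⟨a, ha⟩).trans htn
        rwa [Int.norm_eq_abs] at this
      · simp [ha]

end RothAux
end

section
open MvPolynomial

namespace RothAux

theorem wt_em_sub {m : ℕ} {r : Fin m → ℕ} (w : Fin m → ℝ) (a : Bx r) :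
    ∑ i, w i * ((a i : ℕ) - (r i : ℝ) / 2) = wt w (em a) - (∑ i, w i * r i) / 2 := by
  rw [wt_apply, Finset.sum_div, ← Finset.sum_sub_distrib]
  apply Finset.sum_congr rfl
  intro i _
  rw [em_apply]
  ring

theorem poly_exists {m : ℕ} (r : Fin m → ℕ) (w1 w2 w3 : Fin m → ℝ) (M D : ℝ) (hD : 0 < D)
    (hMD : m * M ^ 2 ≤ D ^ 2) (h1 : ∀ i, |w1 i| * r i ≤ M) (h2 : ∀ i, |w2 i| * r i ≤ M)
    (h3 : ∀ i, |w3 i| * r i ≤ M) :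
    ∃ P : MvPolynomial (Fin m) ℚ, P ≠ 0 ∧ P ∈ IntP m ∧ Deg r P ∧ l1 P ≤ 8 ^ (∑ i, r i) ∧
      (∀ J, coeff J P ≠ 0 → (∑ i, w1 i * r i) / 2 - D ≤ wt w1 J) ∧
      (∀ J, coeff J P ≠ 0 → wt w2 J ≤ (∑ i, w2 i * r i) / 2 + D) ∧
      (∀ J, coeff J (T 1 P) ≠ 0 → (∑ i, w3 i * r i) / 2 - D ≤ wt w3 J) := by
  classical
  set B1 : Finset (Bx r) := Finset.univ.filter fun a => wt w1 (em a) < (∑ i, w1 i * r i) / 2 - D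
    with hB1
  set B2 : Finset (Bx r) := Finset.univ.filter fun a => (∑ i, w2 i * r i) / 2 + D < wt w2 (em a)
    with hB2
  set E : Finset (Bx r) := Finset.univ.filter fun a => wt w3 (em a) < (∑ i, w3 i * r i) / 2 - D
    with hE
  set S : Finset (Bx r) := Finset.univ \ (B1 ∪ B2) with hS
  have c1 : 4 * (B1.card : ℝ) ≤ Fintype.card (Bx r) := by
    apply cheb r w1 M D hD h1 hMD
    intro a ha
    rw [hB1, Finset.mem_filter] at ha
    rw [wt_em_sub, abs_of_neg (by linarith)]
    linarith
  have c2 : 4 * (B2.card : ℝ) ≤ Fintype.card (Bx r) := by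
    apply cheb r w2 M D hD h2 hMD
    intro a ha
    rw [hB2, Finset.mem_filter] at ha
    rw [wt_em_sub, abs_of_pos (by linarith)]
    linarith
  have c3 : 4 * (E.card : ℝ) ≤ Fintype.card (Bx r) := by
    apply cheb r w3 M D hD h3 hMD
    intro a ha
    rw [hE, Finset.mem_filter] at ha
    rw [wt_em_sub, abs_of_neg (by linarith)]
    linarith
  have c1' : 4 * B1.card ≤ Fintype.card (Bx r) := by exact_mod_cast c1
  have c2' : 4 * B2.card ≤ Fintype.card (Bx r) := by exact_mod_cast c2
  have c3' : 4 * E.card ≤ Fintype.card (Bx r) := by exact_mod_cast c3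
  have c4 : S.card + (B1 ∪ B2).card = Fintype.card (Bx r) := by
    rw [hS, Finset.card_sdiff_add_card_eq_card (Finset.subset_univ _), Finset.card_univ]
  have c5 := Finset.card_union_le B1 B2
  have c6 : 0 < Fintype.card (Bx r) := Fintype.card_pos
  obtain ⟨c, hc0, hcS, hcE, hcb⟩ := siegel r S E (by omega) (by omega)
  set P : MvPolynomial (Fin m) ℚ := ∑ a : Bx r, monomial (em a) (c a : ℚ) with hP
  have hco : ∀ a : Bx r, coeff (em a) P = c a := by
    intro a
    rw [hP, coeff_sum, Finset.sum_eq_single a]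
    · simp
    · intro b _ hb
      rw [coeff_monomial, if_neg fun h => hb (em_inj h)]
    · simp
  have hco' : ∀ J, coeff J P ≠ 0 → ∃ a : Bx r, em a = J := by
    intro J hJ
    by_contra hcon
    push Not at hcon
    apply hJ
    rw [hP, coeff_sum]
    apply Finset.sum_eq_zero
    intro a _
    rw [coeff_monomial, if_neg (hcon a)]
  have hdeg : Deg r P := by
    intro J hJ i
    obtain ⟨a, rfl⟩ := hco' J hJ
    exact Nat.lt_succ_iff.mp (a i).2
  have hSm : ∀ J, coeff J P ≠ 0 → ∃ a ∈ S, em a = J := by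
    intro J hJ
    obtain ⟨a, rfl⟩ := hco' J hJ
    refine ⟨a, ?_, rfl⟩
    by_contra ha
    rw [hco, hcS a ha] at hJ
    simp at hJ
  refine ⟨P, ?_, ?_, hdeg, ?_, ?_, ?_, ?_⟩
  · intro h0
    apply hc0
    funext a
    have := hco a
    rw [h0, coeff_zero] at this
    exact_mod_cast this.symm
  · rw [mem_IntP]
    intro J
    by_cases hJ : coeff J P = 0
    · exact ⟨0, by simpa using hJ⟩
    · obtain ⟨a, rfl⟩ := hco' J hJ
      exact ⟨c a, hco a⟩
  · rw [hP]
    refine (l1_sum _ _).trans ?_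
    have : ∀ a : Bx r, l1 (monomial (em a) (c a : ℚ)) ≤ 4 ^ (∑ i, r i) := by
      intro a
      rw [l1_monomial]
      simpa using hcb a
    refine (Finset.sum_le_sum fun a _ => this a).trans ?_
    rw [Finset.sum_const, nsmul_eq_mul, Finset.card_univ]
    have h4 : (Fintype.card (Bx r) : ℝ) ≤ 2 ^ (∑ i, r i) := by exact_mod_cast card_Bx_le r
    calc _ ≤ (2 : ℝ) ^ (∑ i, r i) * 4 ^ (∑ i, r i) := by gcongr
      _ = 8 ^ (∑ i, r i) := by rw [← mul_pow]; norm_num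
  · intro J hJ
    obtain ⟨a, ha, rfl⟩ := hSm J hJ
    rw [hS, Finset.mem_sdiff, Finset.mem_union, not_or, hB1, Finset.mem_filter] at ha
    have := ha.2.1
    simpa using this
  · intro J hJ
    obtain ⟨a, ha, rfl⟩ := hSm J hJ
    rw [hS, Finset.mem_sdiff, Finset.mem_union, not_or, hB2, Finset.mem_filter] at ha
    have := ha.2.2
    simpa using this
  · intro J hJ
    rw [coeff_T _ hdeg] at hJ
    by_contra hcon
    push Not at hcon
    apply hJ
    by_cases hJr : ∀ i, J i ≤ r i
    · obtain ⟨b, rfl⟩ := em_surj J hJr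
      have hb : b ∈ E := by rw [hE, Finset.mem_filter]; exact ⟨Finset.mem_univ _, hcon⟩
      have := congrArg (Int.cast (R := ℚ)) (hcE b hb)
      push_cast at this
      rw [← this]
      apply Finset.sum_congr rfl
      intro a _
      rw [hco]
      simp
    · push Not at hJr
      obtain ⟨i, hi⟩ := hJr
      apply Finset.sum_eq_zero
      intro a _
      rw [Finset.prod_eq_zero (Finset.mem_univ i), mul_zero]
      rw [Nat.choose_eq_zero_of_lt (lt_of_le_of_lt (Nat.lt_succ_iff.mp (a i).2) hi)]
      simp

theorem coeff_T_one_le {m : ℕ} {r : Fin m → ℕ} {P : MvPolynomial (Fin m) ℚ} (hP : Deg r P)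
    (J : Fin m →₀ ℕ) : |((coeff J (T 1 P) : ℚ) : ℝ)| ≤ 2 ^ (∑ i, r i) * l1 P := by
  have hl : l1 P = ∑ a : Bx r, |((coeff (em a) P : ℚ) : ℝ)| := by
    rw [l1_eq (s := Finset.univ.image (em (r := r)))]
    · rw [Finset.sum_image]
      intro a _ b _ h
      exact em_inj h
    · intro J hJ
      obtain ⟨a, rfl⟩ := em_surj J (hP J (mem_support_iff.mp hJ))
      exact Finset.mem_image_of_mem _ (Finset.mem_univ _)
  rw [coeff_T _ hP, hl, Finset.mul_sum]
  push_cast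
  refine (Finset.abs_sum_le_sum_abs _ _).trans (Finset.sum_le_sum fun a _ => ?_)
  rw [abs_mul, mul_comm]
  apply mul_le_mul_of_nonneg_right _ (abs_nonneg _)
  have := prod_choose_le r a J
  simp only [Pi.one_apply, Rat.cast_one, one_pow, mul_one]
  rw [abs_of_nonneg (by positivity)]
  exact_mod_cast this

theorem Deg_T_one {m : ℕ} {r : Fin m → ℕ} {P : MvPolynomial (Fin m) ℚ} (hP : Deg r P) :
    Deg r (T 1 P) := by
  intro J hJ i
  by_contra hi
  push Not at hi
  apply hJ
  rw [coeff_T _ hP]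
  apply Finset.sum_eq_zero
  intro a _
  rw [Finset.prod_eq_zero (Finset.mem_univ i), mul_zero]
  rw [Nat.choose_eq_zero_of_lt (lt_of_le_of_lt (Nat.lt_succ_iff.mp (a i).2) hi)]
  simp

end RothAux
end

section
open MvPolynomial

namespace RothAux

theorem lower {m : ℕ} (r K n : Fin m → ℕ) (A : Fin m → ℤ) (hA : ∀ i, 1 ≤ A i)
    (w1 w2 : Fin m → ℝ) (hw1 : ∀ i, w1 i = K i * Real.log 3) (hw2 : ∀ i, w2 i = n i * Real.log 2)
    (D : ℝ) (P : MvPolynomial (Fin m) ℚ) (hPi : P ∈ IntP m) (hPd : Deg r P)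
    (hP1 : ∀ J, coeff J P ≠ 0 → (∑ i, w1 i * r i) / 2 - D ≤ wt w1 J)
    (hP2 : ∀ J, coeff J P ≠ 0 → wt w2 J ≤ (∑ i, w2 i * r i) / 2 + D)
    (j : Fin m →₀ ℕ)
    (hj : coeff j (T (fun i => ((3 ^ K i : ℤ) : ℚ) / ((2 ^ n i * A i : ℤ) : ℚ)) P) ≠ 0) :
    ((∑ i, w1 i * r i) / 2 - D - wt w1 j) + ((∑ i, w2 i * r i) / 2 - D) ≤
      Real.log |((coeff j (T (fun i => ((3 ^ K i : ℤ) : ℚ) / ((2 ^ n i * A i : ℤ) : ℚ)) P) *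
        ∏ i, ((2 ^ n i * A i : ℤ) : ℚ) ^ (r i - j i) : ℚ) : ℝ)| := by
  have hl3 : 0 < Real.log 3 := Real.log_pos (by norm_num)
  have hl2 : 0 < Real.log 2 := Real.log_pos (by norm_num)
  set Y : Fin m → ℤ := fun i => 2 ^ n i * A i with hY
  have hY0 : ∀ i, Y i ≠ 0 := fun i => mul_ne_zero (by positivity) (by have := hA i; omega)
  have hY0' : ∀ i, (Y i : ℚ) ≠ 0 := fun i => by exact_mod_cast hY0 i
  choose c hc using mem_IntP.mp hPi
  set Z : ℤ := ∑ a : Bx r, c (em a) * ∏ i, (((a i : ℕ).choose (j i) : ℕ) : ℤ) *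
    ((3 ^ K i) ^ ((a i : ℕ) - j i) * Y i ^ (r i - (a i : ℕ))) with hZ
  set Q : ℚ := coeff j (T (fun i => ((3 ^ K i : ℤ) : ℚ) / (Y i : ℚ)) P) *
        ∏ i, (Y i : ℚ) ^ (r i - j i) with hQ
  have hZQ : Q = (Z : ℚ) := by
    rw [hQ, coeff_T _ hPd, hZ, Finset.sum_mul]
    push_cast
    apply Finset.sum_congr rfl
    intro a _
    rw [hc, mul_assoc, ← Finset.prod_mul_distrib]
    congr 1
    apply Finset.prod_congr rfl
    intro i _
    by_cases hij : j i ≤ (a i : ℕ)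
    · have har : (a i : ℕ) ≤ r i := Nat.lt_succ_iff.mp (a i).2
      have e1 : r i - j i = ((a i : ℕ) - j i) + (r i - (a i : ℕ)) := by omega
      rw [e1, pow_add, div_pow, mul_assoc]
      congr 1
      have := pow_ne_zero ((a i : ℕ) - j i) (hY0' i)
      field_simp
    · rw [Nat.choose_eq_zero_of_lt (by omega)]
      simp
  have hQ0 : Q ≠ 0 := mul_ne_zero hj (Finset.prod_ne_zero_iff.mpr fun i _ => pow_ne_zero _ (hY0' i))
  have hZ0 : Z ≠ 0 := by
    intro h
    apply hQ0
    rw [hZQ, h]; simp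
  set u : ℝ := (∑ i, w1 i * r i) / 2 - D - wt w1 j with hu
  set v : ℝ := (∑ i, w2 i * r i) / 2 - D with hv
  set e : ℕ := ⌈u / Real.log 3⌉₊ with he
  set f : ℕ := ⌈v / Real.log 2⌉₊ with hf
  have hdvd : (3 : ℤ) ^ e * 2 ^ f ∣ Z := by
    rw [hZ]
    apply Finset.dvd_sum
    intro a _
    by_cases hca : coeff (em a) P = 0
    · have : c (em a) = 0 := by
        rw [hc] at hca; exact_mod_cast hca
      rw [this, zero_mul]; exact dvd_zero _
    by_cases hja : ∀ i, j i ≤ (a i : ℕ)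
    · apply Dvd.dvd.mul_left
      rw [Finset.prod_mul_distrib]
      apply Dvd.dvd.mul_left
      rw [Finset.prod_mul_distrib]
      have har : ∀ i, (a i : ℕ) ≤ r i := fun i => Nat.lt_succ_iff.mp (a i).2
      apply mul_dvd_mul
      · have : ∏ i, ((3 : ℤ) ^ K i) ^ ((a i : ℕ) - j i) = 3 ^ (∑ i, K i * ((a i : ℕ) - j i)) := by
          rw [← Finset.prod_pow_eq_pow_sum]
          simp only [pow_mul]
        rw [this]
        apply pow_dvd_pow
        rw [he, Nat.ceil_le, div_le_iff₀ hl3]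
        have h1 := hP1 _ hca
        have h2 : ((∑ i, K i * ((a i : ℕ) - j i) : ℕ) : ℝ) * Real.log 3 = wt w1 (em a) - wt w1 j := by
          rw [wt_apply, wt_apply, ← Finset.sum_sub_distrib, Nat.cast_sum, Finset.sum_mul]
          apply Finset.sum_congr rfl
          intro i _
          rw [Nat.cast_mul, Nat.cast_sub (hja i), hw1, em_apply]
          ring
        rw [h2]
        linarith
      · have : ∏ i, Y i ^ (r i - (a i : ℕ)) = 2 ^ (∑ i, n i * (r i - (a i : ℕ))) *
            ∏ i, A i ^ (r i - (a i : ℕ)) := by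
          rw [← Finset.prod_pow_eq_pow_sum, ← Finset.prod_mul_distrib]
          apply Finset.prod_congr rfl
          intro i _
          rw [hY, mul_pow, pow_mul]
        rw [this]
        apply Dvd.dvd.mul_right
        apply pow_dvd_pow
        rw [hf, Nat.ceil_le, div_le_iff₀ hl2]
        have h1 := hP2 _ hca
        have h2 : ((∑ i, n i * (r i - (a i : ℕ)) : ℕ) : ℝ) * Real.log 2 =
            (∑ i, w2 i * r i) - wt w2 (em a) := by
          rw [wt_apply, ← Finset.sum_sub_distrib, Nat.cast_sum, Finset.sum_mul]
          apply Finset.sum_congr rfl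
          intro i _
          rw [Nat.cast_mul, Nat.cast_sub (har i), hw2, em_apply]
          ring
        rw [h2]
        linarith
    · push Not at hja
      obtain ⟨i, hi⟩ := hja
      rw [Finset.prod_eq_zero (Finset.mem_univ i), mul_zero]
      · exact dvd_zero _
      · rw [Nat.choose_eq_zero_of_lt hi]; simp
  have hle : (3 : ℤ) ^ e * 2 ^ f ≤ |Z| := Int.le_of_dvd (abs_pos.mpr hZ0) ((dvd_abs _ _).mpr hdvd)
  have hle' : (3 : ℝ) ^ e * 2 ^ f ≤ |(Z : ℝ)| := by exact_mod_cast hle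
  have hlog := Real.log_le_log (by positivity) hle'
  rw [Real.log_mul (by positivity) (by positivity), Real.log_pow, Real.log_pow] at hlog
  have hue : u ≤ e * Real.log 3 := by
    rw [← div_le_iff₀ hl3]; exact Nat.le_ceil _
  have hvf : v ≤ f * Real.log 2 := by
    rw [← div_le_iff₀ hl2]; exact Nat.le_ceil _
  rw [hZQ]
  push_cast
  linarith

theorem upper {m : ℕ} (r K n : Fin m → ℕ) (A : Fin m → ℤ) (hA : ∀ i, 1 ≤ A i)
    (w1 w3 : Fin m → ℝ) (hw1 : ∀ i, w1 i = K i * Real.log 3)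
    (hB : ∀ i, |((3 ^ K i - 2 ^ n i * A i : ℤ) : ℝ)| ≤ Real.exp (w1 i - w3 i))
    (hY2 : ∀ i, ((2 ^ n i * A i : ℤ) : ℝ) ≤ 2 * 3 ^ K i)
    (D : ℝ) (P : MvPolynomial (Fin m) ℚ) (hPd : Deg r P) (hPl : l1 P ≤ 8 ^ (∑ i, r i))
    (hP3 : ∀ J, coeff J (T 1 P) ≠ 0 → (∑ i, w3 i * r i) / 2 - D ≤ wt w3 J)
    (j : Fin m →₀ ℕ) (hjr : ∀ i, j i ≤ r i) :
    |((coeff j (T (fun i => ((3 ^ K i : ℤ) : ℚ) / ((2 ^ n i * A i : ℤ) : ℚ)) P) *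
        ∏ i, ((2 ^ n i * A i : ℤ) : ℚ) ^ (r i - j i) : ℚ) : ℝ)| ≤
      128 ^ (∑ i, r i) * Real.exp ((∑ i, w1 i * r i) - wt w1 j + wt w3 j -
        (∑ i, w3 i * r i) / 2 + D) := by
  set Y : Fin m → ℤ := fun i => 2 ^ n i * A i with hY
  have hYpos : ∀ i, 0 < Y i := fun i => mul_pos (by positivity) (by have := hA i; omega)
  have hY0' : ∀ i, (Y i : ℚ) ≠ 0 := fun i => by exact_mod_cast (hYpos i).ne'
  set G : ℝ := Real.exp ((∑ i, w1 i * r i) - wt w1 j + wt w3 j - (∑ i, w3 i * r i) / 2 + D) with hG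
  set s : ℕ := ∑ i, r i with hs
  have hT : T (fun i => ((3 ^ K i : ℤ) : ℚ) / (Y i : ℚ)) P =
      T (fun i => ((3 ^ K i - Y i : ℤ) : ℚ) / (Y i : ℚ)) (T 1 P) := by
    rw [T_T]
    congr 2
    funext i
    simp only [Pi.add_apply, Pi.one_apply]
    have := hY0' i
    push_cast
    field_simp
    ring
  have hsum : coeff j (T (fun i => ((3 ^ K i : ℤ) : ℚ) / (Y i : ℚ)) P) *
        ∏ i, (Y i : ℚ) ^ (r i - j i) =
      ∑ a : Bx r, coeff (em a) (T 1 P) * ∏ i, (((a i : ℕ).choose (j i) : ℕ) : ℚ) *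
        (((3 ^ K i - Y i : ℤ) : ℚ) ^ ((a i : ℕ) - j i) * (Y i : ℚ) ^ (r i - (a i : ℕ))) := by
    rw [hT, coeff_T _ (Deg_T_one hPd), Finset.sum_mul]
    apply Finset.sum_congr rfl
    intro a _
    rw [mul_assoc, ← Finset.prod_mul_distrib]
    congr 1
    apply Finset.prod_congr rfl
    intro i _
    by_cases hij : j i ≤ (a i : ℕ)
    · have har : (a i : ℕ) ≤ r i := Nat.lt_succ_iff.mp (a i).2
      have e1 : r i - j i = ((a i : ℕ) - j i) + (r i - (a i : ℕ)) := by omega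
      rw [e1, pow_add, div_pow, mul_assoc]
      congr 1
      have := pow_ne_zero ((a i : ℕ) - j i) (hY0' i)
      field_simp
    · rw [Nat.choose_eq_zero_of_lt (by omega)]
      simp
  rw [hsum, Rat.cast_sum]
  have hterm : ∀ a : Bx r, |((coeff (em a) (T 1 P) * ∏ i, (((a i : ℕ).choose (j i) : ℕ) : ℚ) *
        (((3 ^ K i - Y i : ℤ) : ℚ) ^ ((a i : ℕ) - j i) * (Y i : ℚ) ^ (r i - (a i : ℕ))) : ℚ) : ℝ)|
      ≤ (2 ^ s * 8 ^ s) * (2 ^ s * (2 ^ s * G)) := by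
    intro a
    by_cases hca : coeff (em a) (T 1 P) = 0
    · rw [hca, zero_mul]; simp only [Rat.cast_zero, abs_zero]; positivity
    by_cases hja : ∀ i, j i ≤ (a i : ℕ)
    · have har : ∀ i, (a i : ℕ) ≤ r i := fun i => Nat.lt_succ_iff.mp (a i).2
      rw [Rat.cast_mul, abs_mul]
      apply mul_le_mul _ _ (abs_nonneg _) (by positivity)
      · refine (coeff_T_one_le hPd _).trans ?_
        gcongr
      · rw [Finset.prod_mul_distrib, Rat.cast_mul, abs_mul]
        apply mul_le_mul _ _ (abs_nonneg _) (by positivity)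
        · have := prod_choose_le r a j
          push_cast
          rw [abs_of_nonneg (by positivity)]
          exact_mod_cast this
        · push_cast
          rw [Finset.abs_prod]
          have h1 : ∀ i, |(3 ^ K i - (Y i : ℝ)) ^ ((a i : ℕ) - j i) * (Y i : ℝ) ^ (r i - (a i : ℕ))| ≤
              2 ^ r i * Real.exp (w1 i * r i - w1 i * j i + w3 i * j i - w3 i * (a i : ℕ)) := by
            intro i
            have hYr : (0 : ℝ) < Y i := by exact_mod_cast hYpos i
            have hx : (3 : ℝ) ^ K i = Real.exp (w1 i) := by
              rw [hw1, mul_comm, Real.exp_mul, Real.exp_log (by norm_num), Real.rpow_natCast]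
            have hb := hB i
            have hb' : |3 ^ K i - (Y i : ℝ)| ≤ Real.exp (w1 i - w3 i) := by
              rw [hY]; push_cast at hb ⊢; exact hb
            have hy' : (Y i : ℝ) ≤ 2 * Real.exp (w1 i) := by
              rw [← hx]; exact hY2 i
            rw [abs_mul, abs_pow, abs_pow, abs_of_pos hYr]
            calc _ ≤ Real.exp (w1 i - w3 i) ^ ((a i : ℕ) - j i) *
                  (2 * Real.exp (w1 i)) ^ (r i - (a i : ℕ)) := by gcongr
              _ = 2 ^ (r i - (a i : ℕ)) * Real.exp (w1 i * r i - w1 i * j i + w3 i * j i -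
                    w3 i * (a i : ℕ)) := by
                  rw [mul_pow, ← Real.exp_nat_mul, ← Real.exp_nat_mul, mul_left_comm,
                    ← Real.exp_add, Nat.cast_sub (hja i), Nat.cast_sub (har i)]
                  congr 2
                  ring
              _ ≤ _ := by
                  gcongr
                  · norm_num
                  · omega
          refine (Finset.prod_le_prod (fun i _ => abs_nonneg _) fun i _ => h1 i).trans ?_
          rw [Finset.prod_mul_distrib, Finset.prod_pow_eq_pow_sum, ← Real.exp_sum]
          apply mul_le_mul_of_nonneg_left _ (by positivity)
          rw [hG, Real.exp_le_exp, Finset.sum_sub_distrib, Finset.sum_add_distrib,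
            Finset.sum_sub_distrib]
          have := hP3 _ hca
          rw [wt_apply] at this
          rw [wt_apply, wt_apply]
          simp only [em_apply] at this
          linarith
    · push Not at hja
      obtain ⟨i, hi⟩ := hja
      rw [Finset.prod_eq_zero (Finset.mem_univ i), mul_zero]
      · simp only [Rat.cast_zero, abs_zero]; positivity
      · rw [Nat.choose_eq_zero_of_lt hi]; simp
  refine (Finset.abs_sum_le_sum_abs _ _).trans ((Finset.sum_le_sum fun a _ => hterm a).trans ?_)
  rw [Finset.sum_const, nsmul_eq_mul, Finset.card_univ]
  have h4 : (Fintype.card (Bx r) : ℝ) ≤ 2 ^ s := by exact_mod_cast card_Bx_le r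
  calc _ ≤ (2 : ℝ) ^ s * ((2 ^ s * 8 ^ s) * (2 ^ s * (2 ^ s * G))) := by gcongr
    _ = (2 * 2 * 8 * 2 * 2) ^ s * G := by simp only [mul_pow]; ring
    _ = 128 ^ s * G := by norm_num

theorem zineq {m : ℕ} (ε : ℝ) (r K n : Fin m → ℕ) (A : Fin m → ℤ) (hA : ∀ i, 1 ≤ A i)
    (w1 w2 w3 : Fin m → ℝ) (hw1 : ∀ i, w1 i = K i * Real.log 3)
    (hw2 : ∀ i, w2 i = n i * Real.log 2)
    (hw3 : ∀ i, w3 i = w1 i - w2 i + ε * K i * Real.log 2)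
    (hB : ∀ i, |((3 ^ K i - 2 ^ n i * A i : ℤ) : ℝ)| ≤ Real.exp (w1 i - w3 i))
    (hY2 : ∀ i, ((2 ^ n i * A i : ℤ) : ℝ) ≤ 2 * 3 ^ K i)
    (D : ℝ) (P : MvPolynomial (Fin m) ℚ) (hPi : P ∈ IntP m)
    (hPd : Deg r P) (hPl : l1 P ≤ 8 ^ (∑ i, r i))
    (hP1 : ∀ J, coeff J P ≠ 0 → (∑ i, w1 i * r i) / 2 - D ≤ wt w1 J)
    (hP2 : ∀ J, coeff J P ≠ 0 → wt w2 J ≤ (∑ i, w2 i * r i) / 2 + D)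
    (hP3 : ∀ J, coeff J (T 1 P) ≠ 0 → (∑ i, w3 i * r i) / 2 - D ≤ wt w3 J)
    (j : Fin m →₀ ℕ) (hjr : ∀ i, j i ≤ r i)
    (hj : coeff j (T (fun i => ((3 ^ K i : ℤ) : ℚ) / ((2 ^ n i * A i : ℤ) : ℚ)) P) ≠ 0) :
    ε * Real.log 2 / 2 * ∑ i, (K i * r i : ℝ) ≤ 5 * ∑ i, (r i : ℝ) + 3 * D + wt w3 j := by
  have h1 := lower r K n A hA w1 w2 hw1 hw2 D P hPi hPd hP1 hP2 j hj
  have h2 := upper r K n A hA w1 w3 hw1 hB hY2 D P hPd hPl hP3 j hjr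
  set Q : ℚ := (coeff j (T (fun i => ((3 ^ K i : ℤ) : ℚ) / ((2 ^ n i * A i : ℤ) : ℚ)) P) *
        ∏ i, ((2 ^ n i * A i : ℤ) : ℚ) ^ (r i - j i)) with hQ
  have hQ0 : Q ≠ 0 := by
    refine mul_ne_zero hj (Finset.prod_ne_zero_iff.mpr fun i _ => pow_ne_zero _ ?_)
    have : (2 ^ n i * A i : ℤ) ≠ 0 := mul_ne_zero (by positivity) (by have := hA i; omega)
    exact_mod_cast this
  have hQ1 : 0 < |(Q : ℝ)| := abs_pos.mpr (by exact_mod_cast hQ0)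
  have h3 := Real.log_le_log hQ1 h2
  rw [Real.log_mul (by positivity) (by positivity), Real.log_exp, Real.log_pow] at h3
  have h4 : Real.log 128 ≤ 5 := by
    have : Real.log 128 = 7 * Real.log 2 := by
      rw [show (128 : ℝ) = 2 ^ 7 by norm_num, Real.log_pow]; norm_num
    rw [this]
    linarith [Real.log_two_lt_d9]
  have h5 : ((∑ i, r i : ℕ) : ℝ) * Real.log 128 ≤ 5 * ∑ i, (r i : ℝ) := by
    push_cast
    have : (0 : ℝ) ≤ ∑ i, (r i : ℝ) := Finset.sum_nonneg fun i _ => by positivity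
    nlinarith
  have h6 : ∑ i, w3 i * r i = ∑ i, w1 i * r i - ∑ i, w2 i * r i +
      ε * Real.log 2 * ∑ i, (K i * r i : ℝ) := by
    rw [Finset.mul_sum, ← Finset.sum_sub_distrib, ← Finset.sum_add_distrib]
    apply Finset.sum_congr rfl
    intro i _
    rw [hw3]; ring
  rw [h6] at h3
  linarith

end RothAux
end

section
open MvPolynomial

namespace RothAux

theorem Deg_T {m : ℕ} {r : Fin m → ℕ} {P : MvPolynomial (Fin m) ℚ} (β : Fin m → ℚ)
    (hP : Deg r P) : Deg r (T β P) := by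
  intro J hJ i
  by_contra hi
  push Not at hi
  apply hJ
  rw [coeff_T _ hP]
  apply Finset.sum_eq_zero
  intro a _
  rw [Finset.prod_eq_zero (Finset.mem_univ i), mul_zero]
  rw [Nat.choose_eq_zero_of_lt (lt_of_le_of_lt (Nat.lt_succ_iff.mp (a i).2) hi)]
  simp

theorem exists_seq (p : ℕ → Prop) (hp : ∀ C : ℕ, ∃ K, C ≤ K ∧ p K) (G : ℝ) (C : ℕ) (m : ℕ) :
    ∃ K : Fin m → ℕ, (∀ i, C ≤ K i ∧ p (K i)) ∧ ∀ i j, i < j → G * K j ≤ K i := by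
  induction m with
  | zero => exact ⟨fun _ => 0, fun i => i.elim0, fun i => i.elim0⟩
  | succ m ih =>
    obtain ⟨K, hK, hG⟩ := ih
    obtain ⟨K0, hK0, hp0⟩ := hp (C + ∑ j, ⌈G * K j⌉₊)
    refine ⟨Fin.cons K0 K, ?_, ?_⟩
    · intro i
      refine Fin.cases ?_ (fun i => ?_) i
      · exact ⟨by simp only [Fin.cons_zero]; omega, hp0⟩
      · exact hK i
    · intro i j hij
      obtain ⟨j', rfl⟩ : ∃ j', j = Fin.succ j' :=
        Fin.exists_succ_eq.mpr (Fin.ne_zero_of_lt hij) |>.imp fun _ h => h.symm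
      rw [Fin.cons_succ]
      refine Fin.cases (fun _ => ?_) (fun i hij => ?_) i hij
      · rw [Fin.cons_zero]
        have h1 : ⌈G * K j'⌉₊ ≤ ∑ j, ⌈G * K j⌉₊ :=
          Finset.single_le_sum (f := fun j => ⌈G * K j⌉₊) (fun _ _ => Nat.zero_le _)
            (Finset.mem_univ j')
        have h2 : ⌈G * K j'⌉₊ ≤ K0 := by omega
        exact Nat.ceil_le.mp h2
      · rw [Fin.cons_succ]
        exact hG _ _ (Fin.succ_lt_succ_iff.mp hij)

/-- Consequences of one bad approximation. -/
theorem bad_facts {ε : ℝ} (hε0 : 0 < ε) (hε1 : ε ≤ 1) {K n : ℕ} {A : ℤ} (hK : 1 ≤ ε * K) (hA : 1 ≤ A)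
    (hB : |((3 ^ K - 2 ^ n * A : ℤ) : ℝ)| ≤ Real.exp (n * Real.log 2 - ε * K * Real.log 2)) :
    ((2 ^ n * A : ℤ) : ℝ) ≤ 2 * 3 ^ K ∧ |K * Real.log 3| ≤ 3 * K ∧ |n * Real.log 2| ≤ 3 * K ∧
      |K * Real.log 3 - n * Real.log 2 + ε * K * Real.log 2| ≤ 3 * K := by
  have hl2 : 0 < Real.log 2 := Real.log_pos (by norm_num)
  have hl2' : Real.log 2 ≤ 0.7 := by linarith [Real.log_two_lt_d9]
  have hl3 : 0 < Real.log 3 := Real.log_pos (by norm_num)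
  have hl3' : Real.log 3 ≤ 1.2 := by
    have h1 : Real.log (3 ^ 3) ≤ Real.log (2 ^ 5) := Real.log_le_log (by norm_num) (by norm_num)
    rw [Real.log_pow, Real.log_pow] at h1
    push_cast at h1
    linarith
  have hK1 : (1 : ℝ) ≤ K := by
    have : (0 : ℝ) ≤ K := by positivity
    nlinarith
  have hAr : (1 : ℝ) ≤ A := by exact_mod_cast hA
  have h2n : Real.exp (n * Real.log 2) = 2 ^ n := by
    rw [mul_comm, Real.exp_mul, Real.exp_log (by norm_num), Real.rpow_natCast]
  have hB' : |((3 ^ K - 2 ^ n * A : ℤ) : ℝ)| ≤ 2 ^ n / 2 := by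
    refine hB.trans ?_
    rw [Real.exp_sub, h2n]
    gcongr
    calc (2 : ℝ) = Real.exp (Real.log 2) := (Real.exp_log (by norm_num)).symm
      _ ≤ _ := Real.exp_le_exp.mpr (by nlinarith)
  push_cast at hB'
  rw [abs_le] at hB'
  have hp : (0 : ℝ) < 2 ^ n := by positivity
  have hY : (2 : ℝ) ^ n * A ≤ 2 * 3 ^ K := by nlinarith
  have hn : (2 : ℝ) ^ n ≤ 2 * 3 ^ K := by nlinarith
  have hn' := Real.log_le_log hp hn
  rw [Real.log_mul (by norm_num) (by positivity), Real.log_pow, Real.log_pow] at hn'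
  have e1 : 0 ≤ K * Real.log 3 := by positivity
  have e2 : K * Real.log 3 ≤ 1.2 * K := by nlinarith
  have e3 : (0 : ℝ) ≤ n * Real.log 2 := by positivity
  have e4 : n * Real.log 2 ≤ 2 * K := by linarith
  have e5 : 0 ≤ ε * K * Real.log 2 := by positivity
  have e6 : ε * K * Real.log 2 ≤ K := by nlinarith
  refine ⟨by push_cast; exact hY, ?_, ?_, ?_⟩ <;> rw [abs_le] <;> constructor <;> linarith

set_option maxHeartbeats 1000000 in
theorem no_bad (ε : ℝ) (hε0 : 0 < ε) (hε1 : ε ≤ 1) : ∃ C : ℕ, ∀ K, C ≤ K →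
    ¬ ∃ (n : ℕ) (A : ℤ), 1 ≤ A ∧ ¬ (3 : ℤ) ∣ A ∧
      |((3 ^ K - 2 ^ n * A : ℤ) : ℝ)| ≤ Real.exp (n * Real.log 2 - ε * K * Real.log 2) := by
  by_contra hcon
  push Not at hcon
  have hl2 : 0 < Real.log 2 := Real.log_pos (by norm_num)
  have hl3 : 1 ≤ Real.log 3 := by
    rw [Real.le_log_iff_exp_le (by norm_num)]
    linarith [Real.exp_one_lt_d9]
  set δ : ℝ := ε * Real.log 2 / 2 with hδ
  have hδ0 : 0 < δ := by positivity
  obtain ⟨m', hm'⟩ := exists_nat_ge (5184 / δ ^ 2)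
  set m := m' + 1 with hm
  have hmge : 5184 / δ ^ 2 ≤ m := by rw [hm]; push_cast; linarith
  have hm1 : (1 : ℝ) ≤ m := by rw [hm]; push_cast; linarith [(Nat.cast_nonneg m' : (0:ℝ) ≤ m')]
  rw [div_le_iff₀ (by positivity)] at hmge
  obtain ⟨ω, hω, hroth⟩ := roth m (δ / 24) (by positivity)
  obtain ⟨C, hC⟩ := exists_nat_ge (1 / ε + 40 / δ + 8 * m / ω)
  obtain ⟨K, hK, hKG⟩ := exists_seq _ hcon (max 1 (2 / ω)) C m
  choose hKC n A hA h3A hB using hK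
  have hCpos : 0 < 1 / ε := by positivity
  have hCpos2 : 0 < 40 / δ := by positivity
  have hCpos3 : 0 < 8 * m / ω := by positivity
  have hKr : ∀ i, 1 / ε + 40 / δ + 8 * m / ω ≤ K i := by
    intro i
    refine hC.trans ?_
    exact_mod_cast hKC i
  have hKε : ∀ i, 1 ≤ ε * K i := by
    intro i
    have : 1 / ε ≤ K i := by linarith [hKr i]
    rwa [div_le_iff₀ hε0, mul_comm] at this
  have hKpos : ∀ i, (1 : ℝ) ≤ K i := by
    intro i
    have h0 : (0 : ℝ) < K i := by linarith [hKr i]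
    exact_mod_cast h0
  set N : ℝ := ((K 0 : ℕ) : ℝ) with hN
  have hN1 : 1 ≤ N := hKpos 0
  have hKN : ∀ i, (K i : ℝ) ≤ N := by
    intro i
    by_cases hi : i = 0
    · rw [hi]
    · have h1 := hKG 0 i (Fin.pos_of_ne_zero hi)
      have h2 : (1 : ℝ) ≤ max 1 (2 / ω) := le_max_left _ _
      nlinarith [hKpos i]
  set r : Fin m → ℕ := fun i => ⌈N / K i⌉₊ with hr
  have hr1 : ∀ i, N ≤ K i * r i := by
    intro i
    have h0 := hKpos i
    have := Nat.le_ceil (N / (K i : ℝ))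
    rw [div_le_iff₀ (by linarith)] at this
    rw [mul_comm]; exact this
  have hr2 : ∀ i, K i * r i ≤ 2 * N := by
    intro i
    have h0 := hKpos i
    have h1 : (r i : ℝ) < N / K i + 1 := Nat.ceil_lt_add_one (by positivity)
    have h2 : (K i : ℝ) * r i ≤ K i * (N / K i + 1) := by
      apply mul_le_mul_of_nonneg_left h1.le (by linarith)
    rw [mul_add, mul_div_cancel₀ _ (by linarith)] at h2
    linarith [hKN i]
  have hrpos : ∀ i, 0 < r i := by
    intro i
    rw [hr]
    apply Nat.ceil_pos.mpr
    have := hKpos i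
    positivity
  have hrr : ∀ i j, i < j → (r i : ℝ) ≤ ω * r j := by
    intro i j hij
    have h1 := hKG i j hij
    have h2 : 2 / ω ≤ max 1 (2 / ω) := le_max_right _ _
    have h3 : 2 / ω * K j ≤ K i := by nlinarith [hKpos j]
    have h4 : 2 * K j ≤ ω * K i := by
      rw [div_mul_eq_mul_div, div_le_iff₀ hω] at h3
      linarith
    have hi := hKpos i
    have hj := hKpos j
    have h5 := hr2 i
    have h6 := hr1 j
    -- `r i * K i * K j ≤ 2 N K j ≤ ω N K i ≤ ω r j K j K i`
    have hij0 : (0 : ℝ) < K i * K j := by positivity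
    refine le_of_mul_le_mul_right ?_ hij0
    calc (r i : ℝ) * (K i * K j) = (K i * r i) * K j := by ring
      _ ≤ (2 * N) * K j := by gcongr
      _ = N * (2 * K j) := by ring
      _ ≤ N * (ω * K i) := by gcongr
      _ = ω * K i * N := by ring
      _ ≤ ω * K i * (K j * r j) := by gcongr
      _ = _ := by ring
  have hfacts := fun i => bad_facts hε0 hε1 (hKε i) (hA i) (hB i)
  set w1 : Fin m → ℝ := fun i => K i * Real.log 3 with hw1
  set w2 : Fin m → ℝ := fun i => n i * Real.log 2 with hw2
  set w3 : Fin m → ℝ := fun i => w1 i - w2 i + ε * K i * Real.log 2 with hw3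
  set D : ℝ := δ * m * N / 12 with hD
  have hD0 : 0 < D := by positivity
  have hwM : ∀ (x : ℝ) i, |x| ≤ 3 * K i → |x| * r i ≤ 6 * N := by
    intro x i hx
    have h1 := hr2 i
    have h2 : (0 : ℝ) ≤ r i := by positivity
    nlinarith
  obtain ⟨P, hP0, hPi, hPd, hPl, hP1, hP2, hP3⟩ := poly_exists r w1 w2 w3 (6 * N) D hD0
    (by
      rw [hD]
      have : (δ * m * N / 12) ^ 2 - m * (6 * N) ^ 2 = m * N ^ 2 / 144 * (m * δ ^ 2 - 5184) := by ring
      have h2 : 0 ≤ m * N ^ 2 / 144 * (m * δ ^ 2 - 5184) := by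
        apply mul_nonneg (by positivity); linarith
      linarith)
    (fun i => hwM _ i (hfacts i).2.1) (fun i => hwM _ i (hfacts i).2.2.1)
    (fun i => hwM _ i (hfacts i).2.2.2)
  -- bounds for the sum of the degrees
  have hrs : ∀ B : ℝ, 0 < B → (∀ i, B ≤ K i) → B * ∑ i, (r i : ℝ) ≤ 2 * m * N := by
    intro B hB0 hBK
    rw [Finset.mul_sum]
    calc ∑ i, B * (r i : ℝ) ≤ ∑ i : Fin m, 2 * N := by
          apply Finset.sum_le_sum
          intro i _
          have := hr2 i
          have h2 : (0 : ℝ) ≤ r i := by positivity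
          nlinarith [hBK i]
      _ = 2 * m * N := by
          rw [Finset.sum_const, Finset.card_univ, Fintype.card_fin, nsmul_eq_mul]; ring
  have hrs1 := hrs (40 / δ) hCpos2 (fun i => by linarith [hKr i])
  have hrs2 := hrs (8 * m / ω) hCpos3 (fun i => by linarith [hKr i])
  set s : ℝ := ∑ i, (r i : ℝ) with hs
  have hs0 : 0 ≤ s := Finset.sum_nonneg fun i _ => by positivity
  have hs1 : 20 * s ≤ δ * m * N := by
    rw [div_mul_eq_mul_div, div_le_iff₀ hδ0] at hrs1
    linarith
  have hs2 : 4 * s ≤ ω * N := by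
    rw [div_mul_eq_mul_div, div_le_iff₀ hω] at hrs2
    have : m * (4 * s) ≤ m * (ω * N) := by linarith
    exact le_of_mul_le_mul_left this (by linarith)
  obtain ⟨j, hj, hjw⟩ := hroth r (fun i => 3 ^ K i) (fun i => 2 ^ n i * A i) P hrpos hrr
    (fun i => by positivity)
    (fun i => mul_ne_zero (by positivity) (by have := hA i; omega))
    (fun i => by
      apply IsCoprime.pow_left
      apply IsCoprime.mul_right
      · apply IsCoprime.pow_right
        exact ⟨1, -1, by norm_num⟩
      · exact (Int.prime_three.coprime_iff_not_dvd).mpr (h3A i))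
    hP0 hPi hPd
    (by
      intro i
      have h1 : Real.log (l1 P) ≤ 3 * s := by
        have h2 := Real.log_le_log (by linarith [one_le_l1 hP0 hPi]) hPl
        have h3 : Real.log 8 ≤ 3 := by
          rw [show (8 : ℝ) = 2 ^ 3 by norm_num, Real.log_pow]
          push_cast
          linarith [Real.log_two_lt_d9]
        rw [Real.log_pow] at h2
        have h4 : ((∑ i, r i : ℕ) : ℝ) = s := by rw [hs]; push_cast; rfl
        rw [h4] at h2
        nlinarith
      have h5 : Real.log |(((3 : ℤ) ^ K i : ℤ) : ℝ)| = K i * Real.log 3 := by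
        push_cast
        rw [abs_of_pos (by positivity), Real.log_pow]
      rw [h5]
      have h6 : N ≤ r i * (K i * Real.log 3) := by
        have h7 := hr1 i
        have h8 : (0 : ℝ) ≤ K i * r i := by positivity
        nlinarith
      have h9 : ω * N ≤ ω * (r i * (K i * Real.log 3)) := by gcongr
      linarith)
  have hjr : ∀ i, j i ≤ r i := Deg_T _ hPd j hj
  have hfin := zineq ε r K n A hA w1 w2 w3 (fun _ => rfl) (fun _ => rfl) (fun _ => rfl)
    (by
      intro i
      refine (hB i).trans (le_of_eq ?_)
      simp only [hw3, hw2]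
      congr 1
      ring)
    (fun i => (hfacts i).1) D P hPi hPd hPl hP1 hP2 hP3 j hjr hj
  have hKs : m * N ≤ ∑ i, (K i * r i : ℝ) := by
    calc m * N = ∑ i : Fin m, N := by
          rw [Finset.sum_const, Finset.card_univ, Fintype.card_fin, nsmul_eq_mul]
      _ ≤ _ := Finset.sum_le_sum fun i _ => hr1 i
  have hwj : wt w3 j ≤ δ / 4 * N := by
    have h1 : wt w3 j ≤ 6 * N * ∑ i, (r i : ℝ)⁻¹ * j i := by
      rw [wt_apply, Finset.mul_sum]
      apply Finset.sum_le_sum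
      intro i _
      have h2 := hwM _ i (hfacts i).2.2.2
      have h3 : (0 : ℝ) < r i := by exact_mod_cast hrpos i
      have h4 : w3 i ≤ 6 * N * (r i : ℝ)⁻¹ := by
        rw [← div_eq_mul_inv, le_div_iff₀ h3]
        refine le_trans ?_ h2
        exact mul_le_mul_of_nonneg_right (le_abs_self _) h3.le
      rw [← mul_assoc]
      exact mul_le_mul_of_nonneg_right h4 (by positivity)
    have h5 : 6 * N * ∑ i, (r i : ℝ)⁻¹ * j i ≤ 6 * N * (δ / 24) := by gcongr
    linarith
  have h1 : δ * (m * N) ≤ δ * ∑ i, (K i * r i : ℝ) := by gcongr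
  have h2 : δ / 4 * N ≤ δ / 4 * (m * N) := by
    apply mul_le_mul_of_nonneg_left _ (by positivity)
    nlinarith
  have h3 : 0 < δ * (m * N) := by positivity
  have h4 : 3 * D = δ * (m * N) / 4 := by rw [hD]; ring
  rw [← hδ, ← hs] at hfin
  linarith

end RothAux
end

namespace RothAux

theorem block_decomp {M a l : ℕ} (hl : 1 ≤ l) (hlen : a + l ≤ (Nat.digits 2 M).length)
    (hbit : ∀ j < l, M.testBit (a + j) = M.testBit a) :
    ∃ A : ℕ, 1 ≤ A ∧ |((M : ℤ) - 2 ^ (a + l) * A)| ≤ 2 ^ a := by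
  have h1 : M = 2 ^ (a + l) * (M / 2 ^ (a + l)) + 2 ^ a * (M / 2 ^ a % 2 ^ l) + M % 2 ^ a := by
    have e1 := Nat.div_add_mod M (2 ^ a)
    have e2 := Nat.div_add_mod (M / 2 ^ a) (2 ^ l)
    rw [Nat.div_div_eq_div_mul, ← pow_add] at e2
    calc M = 2 ^ a * (M / 2 ^ a) + M % 2 ^ a := e1.symm
      _ = 2 ^ a * (2 ^ l * (M / 2 ^ (a + l)) + M / 2 ^ a % 2 ^ l) + M % 2 ^ a := by rw [e2]
      _ = _ := by ring
  have hmod : M % 2 ^ a < 2 ^ a := Nat.mod_lt _ (by positivity)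
  set q := M / 2 ^ (a + l) with hq
  set t := M % 2 ^ a with ht
  have hpow : (2 : ℤ) ^ (a + l) = 2 ^ a * 2 ^ l := pow_add _ _ _
  have hbits : ∀ i, (M / 2 ^ a % 2 ^ l).testBit i = (decide (i < l) && M.testBit a) := by
    intro i
    rw [Nat.testBit_mod_two_pow, Nat.testBit_div_two_pow]
    by_cases hi : i < l
    · simp only [hi, decide_true, Bool.true_and]
      rw [add_comm, hbit i hi]
    · simp [hi]
  rcases hb : M.testBit a with _ | _
  · have h0 : M / 2 ^ a % 2 ^ l = 0 := by
      apply Nat.eq_of_testBit_eq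
      intro i
      rw [hbits, hb]; simp
    rw [h0, mul_zero, add_zero] at h1
    refine ⟨q, ?_, ?_⟩
    · by_contra hq0
      have hq0' : q = 0 := Nat.lt_one_iff.mp (not_le.mp hq0)
      rw [hq0', mul_zero, zero_add] at h1
      have h2 : M < 2 ^ a := by rw [h1]; exact hmod
      have h3 := (Nat.digits_length_le_iff (b := 2) (by norm_num) (k := a) M).mpr h2
      omega
    · have h2 : (M : ℤ) - 2 ^ (a + l) * q = t := by
        have : (M : ℤ) = 2 ^ (a + l) * q + t := by exact_mod_cast h1
        linarith
      rw [h2, abs_of_nonneg (by positivity)]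
      exact_mod_cast hmod.le
  · have h0 : M / 2 ^ a % 2 ^ l = 2 ^ l - 1 := by
      apply Nat.eq_of_testBit_eq
      intro i
      rw [hbits, hb, Nat.testBit_two_pow_sub_one]; simp
    refine ⟨q + 1, Nat.le_add_left 1 q, ?_⟩
    rw [h0] at h1
    have h2 : (M : ℤ) = 2 ^ (a + l) * q + 2 ^ a * (2 ^ l - 1) + t := by
      have h3 : 1 ≤ 2 ^ l := Nat.one_le_two_pow
      have := congrArg (Nat.cast (R := ℤ)) h1
      push_cast [Nat.cast_sub h3] at this
      exact this
    have h3 : (t : ℤ) < 2 ^ a := by exact_mod_cast hmod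
    have h4 : (0 : ℤ) ≤ t := by positivity
    have h5 : (M : ℤ) - 2 ^ (a + l) * ((q + 1 : ℕ) : ℤ) = t - 2 ^ a := by
      push_cast
      rw [h2, hpow]; ring
    rw [h5, abs_le]
    constructor <;> linarith

theorem block_bad {K a l A : ℕ} (hl : 3 ≤ l) (hA : 1 ≤ A)
    (hB : |(((3 ^ K : ℕ) : ℤ) - 2 ^ (a + l) * A)| ≤ 2 ^ a) :
    ∃ (K' : ℕ) (A' : ℤ), K' ≤ K ∧ l ≤ 2 * K' + 1 ∧ 1 ≤ A' ∧ ¬ (3 : ℤ) ∣ A' ∧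
      |(3 ^ K' - 2 ^ (a + l) * A' : ℤ)| ≤ 2 ^ a := by
  obtain ⟨j, A', h3, hAj⟩ := Nat.exists_eq_pow_mul_and_not_dvd (n := A) (by omega) 3 (by norm_num)
  set B : ℤ := ((3 ^ K : ℕ) : ℤ) - 2 ^ (a + l) * A with hBdef
  push_cast at hBdef
  have hA'1 : 1 ≤ A' := by
    rcases Nat.eq_zero_or_pos A' with h | h
    · subst h; simp at h3
    · exact h
  have hB0 : B ≠ 0 := by
    intro h0
    have h1 : (3 : ℤ) ^ K = 2 ^ (a + l) * A := by linarith
    have h2 : (2 : ℤ) ∣ 3 ^ K := by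
      rw [h1]; exact Dvd.dvd.mul_right (dvd_pow_self _ (by omega)) _
    have h4 := Int.prime_two.dvd_of_dvd_pow h2
    norm_num at h4
  have hpow : (2 : ℤ) ^ (a + l) = 2 ^ a * 2 ^ l := pow_add _ _ _
  have hl8 : (8 : ℤ) ≤ 2 ^ l := by
    calc (8 : ℤ) = 2 ^ 3 := by norm_num
      _ ≤ 2 ^ l := pow_le_pow_right₀ (by norm_num) hl
  have ha0 : (0 : ℤ) < 2 ^ a := by positivity
  have hAz : (1 : ℤ) ≤ A := by exact_mod_cast hA
  have hbig : (2 : ℤ) ^ a * 2 ^ (l - 1) ≤ 3 ^ K := by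
    have e1 : (2 : ℤ) ^ l = 2 * 2 ^ (l - 1) := by
      rw [← pow_succ']; congr 1; omega
    have e2 := (abs_le.mp hB).1
    have e3 : (2 : ℤ) ^ (a + l) * 1 ≤ 2 ^ (a + l) * A := by gcongr
    rw [hpow, e1] at e3
    rw [hpow, e1] at hBdef
    have e4 : (1 : ℤ) ≤ 2 ^ (l - 1) := one_le_pow₀ (by norm_num)
    nlinarith
  have hmin : (3 : ℤ) ^ (min j K) ∣ B := by
    rw [hBdef]
    apply dvd_sub
    · exact pow_dvd_pow _ (min_le_right _ _)
    · apply Dvd.dvd.mul_left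
      rw [hAj]
      push_cast
      exact Dvd.dvd.mul_right (pow_dvd_pow _ (min_le_left _ _)) _
  have hle : (3 : ℤ) ^ (min j K) ≤ 2 ^ a :=
    (Int.le_of_dvd (abs_pos.mpr hB0) ((dvd_abs _ _).mpr hmin)).trans hB
  have hjK : j < K := by
    by_contra hcon
    rw [min_eq_right (by omega)] at hle
    have e1 : (2 : ℤ) ^ 1 ≤ 2 ^ (l - 1) := pow_le_pow_right₀ (by norm_num) (by omega)
    nlinarith
  rw [min_eq_left hjK.le] at hle
  have hK : (3 : ℤ) ^ K = 3 ^ j * 3 ^ (K - j) := by rw [← pow_add]; congr 1; omega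
  refine ⟨K - j, A', by omega, ?_, by exact_mod_cast hA'1, by exact_mod_cast h3, ?_⟩
  · have h1 : (2 : ℤ) ^ (l - 1) ≤ 3 ^ (K - j) := by
      have h3j : (0 : ℤ) < 3 ^ j := by positivity
      refine le_of_mul_le_mul_left ?_ h3j
      rw [← hK]
      refine le_trans ?_ hbig
      gcongr
    have h2 : (2 : ℤ) ^ (l - 1) ≤ 2 ^ (2 * (K - j)) := by
      refine h1.trans ?_
      rw [pow_mul]
      gcongr
      norm_num
    have h4 := (pow_le_pow_iff_right₀ (by norm_num : (1 : ℤ) < 2)).mp h2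
    omega
  · have h1 : B = 3 ^ j * (3 ^ (K - j) - 2 ^ (a + l) * A') := by
      rw [hBdef, hK, hAj]; push_cast; ring
    rw [h1, abs_mul] at hB
    have h2 : (1 : ℤ) ≤ |(3 : ℤ) ^ j| := by
      rw [abs_of_pos (by positivity)]; exact one_le_pow₀ (by norm_num)
    have h3 := abs_nonneg ((3 : ℤ) ^ (K - j) - 2 ^ (a + l) * A')
    nlinarith

end RothAux

theorem stmt10 :
    ∀ ε > (0:ℝ), ∃ K₀ : ℕ, ∀ K : ℕ, K₀ ≤ K →
      (runLength (3 ^ K) : ℝ) ≤ ε * K := by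
  intro ε₀ hε₀
  set ε := min ε₀ 1 with hε
  have hε0 : 0 < ε := lt_min hε₀ one_pos
  obtain ⟨C, hC⟩ := RothAux.no_bad ε hε0 (min_le_right _ _)
  obtain ⟨K₀, hK₀⟩ := exists_nat_ge ((2 * C + 3) / ε)
  refine ⟨K₀, fun K hK => ?_⟩
  by_contra hcon
  push Not at hcon
  have hl2 : 0 < Real.log 2 := Real.log_pos (by norm_num)
  have hKr : (K₀ : ℝ) ≤ K := by exact_mod_cast hK
  have h1 : (2 * C + 3 : ℝ) ≤ ε * K := by
    have := hK₀.trans hKr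
    rw [div_le_iff₀ hε0] at this
    linarith
  have hK0 : (0 : ℝ) ≤ K := by positivity
  have h2 : ε * K ≤ ε₀ * K := mul_le_mul_of_nonneg_right (min_le_left _ _) hK0
  have hmem : runLength (3 ^ K) ∈ {l | ∃ a, a + l ≤ (Nat.digits 2 (3 ^ K)).length ∧
      ∀ j < l, (3 ^ K).testBit (a + j) = (3 ^ K).testBit a} := by
    apply Nat.sSup_mem
    · exact ⟨0, 0, by simp, by simp⟩
    · refine ⟨(Nat.digits 2 (3 ^ K)).length, ?_⟩
      rintro l ⟨a, ha, _⟩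
      omega
  set l := runLength (3 ^ K) with hldef
  obtain ⟨a, hlen, hbit⟩ := hmem
  have hlr : ε * K ≤ l := by linarith
  have hlC : 2 * C + 3 ≤ l := by
    have : (2 * C + 3 : ℝ) ≤ l := by linarith
    exact_mod_cast this
  obtain ⟨A, hA, hB⟩ := RothAux.block_decomp (by omega) hlen hbit
  obtain ⟨K', A', hKK, hlK, hA', h3, hB'⟩ := RothAux.block_bad (by omega) hA hB
  refine hC K' (by omega) ⟨a + l, A', hA', h3, ?_⟩
  have h5 : |((3 ^ K' - 2 ^ (a + l) * A' : ℤ) : ℝ)| ≤ 2 ^ a := by exact_mod_cast hB'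
  refine h5.trans ?_
  have h6 : (2 : ℝ) ^ a = Real.exp (a * Real.log 2) := by
    rw [mul_comm, Real.exp_mul, Real.exp_log (by norm_num), Real.rpow_natCast]
  rw [h6, Real.exp_le_exp]
  have h7 : ε * K' ≤ l := by
    have : (K' : ℝ) ≤ K := by exact_mod_cast hKK
    nlinarith
  push_cast
  nlinarith
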